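/- Every signed 2-edge-connected simple subcubic graph (G, σ), other than the five exceptional signed graphs Γ̂₁ (K₄ with a negative perfect matching), Γ̂₂ (the 5-vertex subdivision of Γ̂₁ with two non-adjacent negative edges), and the three exceptional 8-vertex signed cubic graphs Γ̂₃, Γ̂₄, Γ̂₅, satisfies F(G, σ) ≤ v(G)/3. -/

import Mathlib

open scoped Classical

/-- The Boolean indicating whether an edge crosses the vertex set `X`. -/
noncomputable def sgnCross {V : Type*} (X : Set V) : Sym2 V → Bool :=
  Sym2.lift ⟨fun a b => xor (decide (a ∈ X)) (decide (b ∈ X)),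
    fun a b => Bool.xor_comm _ _⟩

/-- The signature obtained from `σ` by switching at the edge-cut `[X, Xᶜ]`:
the signs of all edges crossing `X` are flipped.  (`true` = negative.) -/
noncomputable def sgnSwitch {V : Type*} (σ : Sym2 V → Bool) (X : Set V) : Sym2 V → Bool :=
  fun e => xor (σ e) (sgnCross X e)

/-- The number of negative edges of the signed graph `(G, σ)`. -/
noncomputable def negNum {V : Type*} (G : SimpleGraph V) (σ : Sym2 V → Bool) : ℕ :=
  {e | e ∈ G.edgeSet ∧ σ e = true}.ncard

/-- The frustration index of `(G, σ)`: the minimum number of negative edges over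
all switching-equivalent signatures. -/
noncomputable def frust {V : Type*} (G : SimpleGraph V) (σ : Sym2 V → Bool) : ℕ :=
  ⨅ X : Set V, negNum G (sgnSwitch σ X)

/-- The number of edges of `G` in the edge-cut `[X, Xᶜ]`. -/
noncomputable def cutSize {V : Type*} (G : SimpleGraph V) (X : Set V) : ℕ :=
  {e | e ∈ G.edgeSet ∧ sgnCross X e = true}.ncard

/-- A graph is 2-edge-connected if every edge-cut has at least 2 edges. -/
def TwoEdgeConn {V : Type*} (G : SimpleGraph V) : Prop :=
  ∀ X : Set V, X.Nonempty → Xᶜ.Nonempty → 2 ≤ cutSize G X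

/-- Switching-isomorphism of signed graphs: a graph isomorphism carrying the first
signature, up to a switching, to the second. -/
def SIso {V W : Type*} (G : SimpleGraph V) (σ : Sym2 V → Bool)
    (H : SimpleGraph W) (τ : Sym2 W → Bool) : Prop :=
  ∃ (φ : G ≃g H) (X : Set V), ∀ e ∈ G.edgeSet,
    sgnSwitch σ X e = τ (Sym2.map (fun v => φ v) e)

/-- `K₄`. -/
def gamma1G : SimpleGraph (Fin 4) := ⊤

/-- The negative perfect matching of `K₄`. -/
noncomputable def gamma1S : Sym2 (Fin 4) → Bool :=
  fun e => decide (e = s(0, 1) ∨ e = s(2, 3))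

/-- `Γ₂`: `K₄` with the edge `{1,2}` subdivided by the vertex `4`. -/
def gamma2G : SimpleGraph (Fin 5) :=
  SimpleGraph.fromEdgeSet {s(0,1), s(0,2), s(0,3), s(1,3), s(2,3), s(1,4), s(2,4)}

noncomputable def gamma2S : Sym2 (Fin 5) → Bool :=
  fun e => decide (e = s(0, 3) ∨ e = s(1, 4))

/-- `Γ₃`. -/
def gamma3G : SimpleGraph (Fin 8) :=
  SimpleGraph.fromEdgeSet {s(1,2), s(2,3), s(3,4), s(4,5), s(1,6), s(5,6),
    s(0,2), s(0,6), s(0,1), s(7,3), s(7,5), s(7,4)}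

noncomputable def gamma3S : Sym2 (Fin 8) → Bool :=
  fun e => decide (e = s(5, 6) ∨ e = s(0, 1) ∨ e = s(7, 4))

/-- `Γ₄`. -/
def gamma4G : SimpleGraph (Fin 8) :=
  SimpleGraph.fromEdgeSet {s(1,2), s(2,3), s(4,5), s(5,1), s(3,6), s(4,6),
    s(1,0), s(0,7), s(7,6), s(0,2), s(3,4), s(5,7)}

noncomputable def gamma4S : Sym2 (Fin 8) → Bool :=
  fun e => decide (e = s(0, 2) ∨ e = s(3, 4) ∨ e = s(5, 7))

/-- `Γ₅`: the cube. -/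
def gamma5G : SimpleGraph (Fin 8) :=
  SimpleGraph.fromEdgeSet {s(0,1), s(1,2), s(2,3), s(3,0), s(4,5), s(5,6),
    s(6,7), s(7,4), s(0,4), s(1,5), s(2,6), s(3,7)}

noncomputable def gamma5S : Sym2 (Fin 8) → Bool :=
  fun e => decide (e = s(3, 0) ∨ e = s(6, 7) ∨ e = s(1, 5))

namespace SubcubicFrustration

section

variable {V : Type*}

/-- The number of edges of `G` joining `A` to `B`, as ordered pairs in `A × B`. -/
noncomputable def eb (G : SimpleGraph V) (A B : Finset V) : ℕ :=
  ∑ a ∈ A, ∑ b ∈ B, if G.Adj a b then 1 else 0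

/-- The number of ordered pairs in `A × B` forming an edge whose sign is not explained by
the vertex colouring `c`. -/
noncomputable def bd (G : SimpleGraph V) (σ : Sym2 V → Bool) (c : V → Bool) (A B : Finset V) : ℕ :=
  ∑ a ∈ A, ∑ b ∈ B, if G.Adj a b ∧ σ s(a, b) ≠ xor (c a) (c b) then 1 else 0

/-- The signed subgraph induced by `S` has frustration index at most `k`. -/
def FrustLE (G : SimpleGraph V) (σ : Sym2 V → Bool) (S : Finset V) (k : ℕ) : Prop :=
  ∃ c : V → Bool, bd G σ c S S ≤ 2 * k

/-- The subgraph induced by `S` is 2-edge-connected. -/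
def TwoConnOn (G : SimpleGraph V) (S : Finset V) : Prop :=
  ∀ X ⊆ S, X.Nonempty → X ≠ S → 2 ≤ eb G X (S \ X)

section Counting

variable (G : SimpleGraph V) (σ : Sym2 V → Bool) (c : V → Bool)

lemma eb_comm (A B : Finset V) : eb G A B = eb G B A := by
  unfold eb
  rw [Finset.sum_comm]
  simp only [G.adj_comm]

lemma eb_union_left {A A' : Finset V} (h : Disjoint A A') (B : Finset V) :
    eb G (A ∪ A') B = eb G A B + eb G A' B := Finset.sum_union h

lemma eb_union_right (A : Finset V) {B B' : Finset V} (h : Disjoint B B') :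
    eb G A (B ∪ B') = eb G A B + eb G A B' := by
  rw [eb_comm, eb_union_left G h, eb_comm G B, eb_comm G B']

lemma eb_mono_right (A : Finset V) {B B' : Finset V} (h : B ⊆ B') : eb G A B ≤ eb G A B' :=
  Finset.sum_le_sum fun _ _ => Finset.sum_le_sum_of_subset h

lemma eb_mono_left {A A' : Finset V} (h : A ⊆ A') (B : Finset V) : eb G A B ≤ eb G A' B :=
  Finset.sum_le_sum_of_subset h

lemma eb_singleton (v : V) (B : Finset V) : eb G {v} B = (B.filter (G.Adj v)).card := by
  simp [eb]

lemma eb_self_singleton (v : V) : eb G {v} {v} = 0 := by simp [eb]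

lemma eb_empty_left (B : Finset V) : eb G ∅ B = 0 := rfl

lemma eb_eq_sum (A B : Finset V) : eb G A B = ∑ a ∈ A, eb G {a} B := by
  simp [eb]

lemma eb_pos_iff (A B : Finset V) : 0 < eb G A B ↔ ∃ a ∈ A, ∃ b ∈ B, G.Adj a b := by
  rw [Nat.pos_iff_ne_zero]
  simp [eb, Finset.sum_eq_zero_iff]

lemma eb_eq_zero_iff (A B : Finset V) : eb G A B = 0 ↔ ∀ a ∈ A, ∀ b ∈ B, ¬ G.Adj a b := by
  simp [eb, Finset.sum_eq_zero_iff]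

lemma eb_split_right {S B : Finset V} (h : B ⊆ S) (A : Finset V) :
    eb G A S = eb G A B + eb G A (S \ B) := by
  rw [← eb_union_right G A Finset.disjoint_sdiff, Finset.union_sdiff_of_subset h]

lemma eb_split_left {S B : Finset V} (h : B ⊆ S) (A : Finset V) :
    eb G S A = eb G B A + eb G (S \ B) A := by
  rw [eb_comm, eb_split_right G h, eb_comm G A B, eb_comm G A]

lemma bd_comm (A B : Finset V) : bd G σ c A B = bd G σ c B A := by
  unfold bd
  rw [Finset.sum_comm]
  refine Finset.sum_congr rfl fun a _ => Finset.sum_congr rfl fun b _ => ?_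
  rw [G.adj_comm, Sym2.eq_swap, Bool.xor_comm]

lemma bd_union_left {A A' : Finset V} (h : Disjoint A A') (B : Finset V) :
    bd G σ c (A ∪ A') B = bd G σ c A B + bd G σ c A' B := Finset.sum_union h

lemma bd_union_right (A : Finset V) {B B' : Finset V} (h : Disjoint B B') :
    bd G σ c A (B ∪ B') = bd G σ c A B + bd G σ c A B' := by
  rw [bd_comm, bd_union_left G σ c h, bd_comm G σ c B, bd_comm G σ c B']

lemma bd_union_self {A B : Finset V} (h : Disjoint A B) :
    bd G σ c (A ∪ B) (A ∪ B) = bd G σ c A A + bd G σ c B B + 2 * bd G σ c A B := by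
  rw [bd_union_left G σ c h, bd_union_right G σ c _ h, bd_union_right G σ c _ h,
    bd_comm G σ c B A]
  ring

variable {G σ} in
lemma bd_congr {c' : V → Bool} {A B : Finset V} (hA : ∀ a ∈ A, c a = c' a)
    (hB : ∀ b ∈ B, c b = c' b) : bd G σ c A B = bd G σ c' A B :=
  Finset.sum_congr rfl fun a ha => Finset.sum_congr rfl fun b hb => by rw [hA a ha, hB b hb]

end Counting

variable {G : SimpleGraph V} {σ : Sym2 V → Bool} {S : Finset V}

lemma FrustLE.mono {k l : ℕ} (h : FrustLE G σ S k) (hkl : k ≤ l) : FrustLE G σ S l := by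
  obtain ⟨c, hc⟩ := h
  exact ⟨c, by omega⟩

/-- Joining two vertex-disjoint pieces costs at most half of the edges between them. -/
lemma FrustLE.union {A B : Finset V} {k l m : ℕ} (hA : FrustLE G σ A k) (hB : FrustLE G σ B l)
    (h : Disjoint A B) (hm : eb G A B ≤ 2 * m + 1) : FrustLE G σ (A ∪ B) (k + l + m) := by
  obtain ⟨c₁, h₁⟩ := hA
  obtain ⟨c₂, h₂⟩ := hB
  let c : Bool → V → Bool := fun t v => if v ∈ A then c₁ v else xor t (c₂ v)
  have hcA : ∀ t, ∀ a ∈ A, c t a = c₁ a := fun t a ha => by simp [c, ha]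
  have hcB : ∀ t, ∀ b ∈ B, c t b = xor t (c₂ b) := fun t b hb => by
    simp [c, Finset.disjoint_right.mp h hb]
  have hAA : ∀ t, bd G σ (c t) A A = bd G σ c₁ A A := fun t => bd_congr _ (hcA t) (hcA t)
  have hBB : ∀ t, bd G σ (c t) B B = bd G σ c₂ B B := fun t => by
    refine Finset.sum_congr rfl fun a ha => Finset.sum_congr rfl fun b hb => ?_
    rw [hcB t a ha, hcB t b hb]
    cases t <;> simp
  have hAB : bd G σ (c false) A B + bd G σ (c true) A B = eb G A B := by
    unfold bd eb
    rw [← Finset.sum_add_distrib]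
    refine Finset.sum_congr rfl fun a ha => ?_
    rw [← Finset.sum_add_distrib]
    refine Finset.sum_congr rfl fun b hb => ?_
    rw [hcB _ b hb, hcB _ b hb, hcA _ a ha, hcA _ a ha]
    by_cases hab : G.Adj a b <;> cases σ s(a, b) <;> cases c₁ a <;> cases c₂ b <;> simp [hab]
  have key : ∀ t, bd G σ (c t) A B ≤ m → FrustLE G σ (A ∪ B) (k + l + m) := fun t ht =>
    ⟨c t, by rw [bd_union_self G σ _ h, hAA, hBB]; omega⟩
  by_cases hf : bd G σ (c false) A B ≤ m
  · exact key _ hf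
  · exact key true (by omega)

lemma frustLE_singleton (v : V) : FrustLE G σ {v} 0 := ⟨fun _ => false, by simp [bd]⟩

lemma frustLE_empty : FrustLE G σ ∅ 0 := ⟨fun _ => false, by simp [bd]⟩

/-- Adding one vertex costs at most half of its degree. -/
lemma FrustLE.insert {v : V} {k m : ℕ} (hv : v ∈ S) (h : FrustLE G σ (S.erase v) k)
    (hm : eb G {v} S ≤ 2 * m + 1) : FrustLE G σ S (k + m) := by
  have := FrustLE.union h (frustLE_singleton v) (m := m) (by simp)
    (by rw [eb_comm]; exact (eb_mono_right G _ (Finset.erase_subset _ _)).trans hm)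
  simpa [Finset.union_comm, ← Finset.insert_eq, Finset.insert_erase hv] using this

end

section

variable {V : Type*} {G : SimpleGraph V} {σ : Sym2 V → Bool} {S : Finset V}

/-- The vertex `x` has exactly the two neighbours `p` and `q` in `S`, and these are not adjacent,
so that `x` can be suppressed. -/
structure Suppressible (G : SimpleGraph V) (S : Finset V) (x p q : V) : Prop where
  mem : x ∈ S
  mem_left : p ∈ S
  mem_right : q ∈ S
  ne : p ≠ q
  adj_left : G.Adj x p
  adj_right : G.Adj x q
  not_adj : ¬ G.Adj p q
  eq_or : ∀ w ∈ S, G.Adj x w → w = p ∨ w = q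

section AddEdge

variable {p q : V} {G' : SimpleGraph V}

lemma sum_sum_ite_eq_and_eq (u w : V) (k : ℕ) (A B : Finset V) :
    (∑ a ∈ A, ∑ b ∈ B, if a = u ∧ b = w then k else 0) = if u ∈ A ∧ w ∈ B then k else 0 := by
  simp only [ite_and]
  by_cases hw : w ∈ B <;> by_cases hu : u ∈ A <;> simp [hw, hu]

lemma eb_add_edge (hpq : ¬ G.Adj p q) (hne : p ≠ q)
    (hG : ∀ a b, G'.Adj a b ↔ G.Adj a b ∨ (a = p ∧ b = q) ∨ (a = q ∧ b = p)) (A B : Finset V) :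
    eb G' A B =
      eb G A B + ((if p ∈ A ∧ q ∈ B then 1 else 0) + if q ∈ A ∧ p ∈ B then 1 else 0) := by
  have hqp : ¬ G.Adj q p := fun h => hpq h.symm
  rw [← sum_sum_ite_eq_and_eq p q 1 A B, ← sum_sum_ite_eq_and_eq q p 1 A B]
  unfold eb
  simp only [← Finset.sum_add_distrib]
  refine Finset.sum_congr rfl fun a _ => Finset.sum_congr rfl fun b _ => ?_
  by_cases h1 : a = p ∧ b = q
  · obtain ⟨rfl, rfl⟩ := h1
    simp [hG, hpq, hne]
  · by_cases h2 : a = q ∧ b = p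
    · obtain ⟨rfl, rfl⟩ := h2
      simp [hG, hqp, hne]
    · simp only [hG, h1, h2, or_false, if_false, add_zero]

lemma bd_add_edge (hpq : ¬ G.Adj p q) (hne : p ≠ q)
    (hG : ∀ a b, G'.Adj a b ↔ G.Adj a b ∨ (a = p ∧ b = q) ∨ (a = q ∧ b = p))
    (t : Bool) (c : V → Bool) (A : Finset V) (hp : p ∈ A) (hq : q ∈ A) :
    bd G' (Function.update σ s(p, q) t) c A A =
      bd G σ c A A + 2 * if t ≠ xor (c p) (c q) then 1 else 0 := by
  have hqp : ¬ G.Adj q p := fun h => hpq h.symm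
  have e : (2 * if t ≠ xor (c p) (c q) then 1 else 0) =
      (∑ a ∈ A, ∑ b ∈ A, if a = p ∧ b = q then (if t ≠ xor (c p) (c q) then 1 else 0) else 0) +
      ∑ a ∈ A, ∑ b ∈ A, if a = q ∧ b = p then (if t ≠ xor (c p) (c q) then 1 else 0) else 0 := by
    rw [sum_sum_ite_eq_and_eq, sum_sum_ite_eq_and_eq]
    simp only [hp, hq, and_self, if_true]
    omega
  rw [e]
  unfold bd
  simp only [← Finset.sum_add_distrib]
  refine Finset.sum_congr rfl fun a _ => Finset.sum_congr rfl fun b _ => ?_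
  by_cases h1 : a = p ∧ b = q
  · obtain ⟨rfl, rfl⟩ := h1
    simp [hG, hpq, hne]
  · by_cases h2 : a = q ∧ b = p
    · obtain ⟨rfl, rfl⟩ := h2
      simp [hG, hqp, hne, Sym2.eq_swap, Bool.xor_comm (c a)]
    · have : s(a, b) ≠ s(p, q) := fun h => by
        rcases Sym2.eq_iff.mp h with h | h
        exacts [h1 h, h2 h]
      simp only [hG, h1, h2, or_false, if_false, add_zero, Function.update_of_ne this]

lemma sup_edge_adj_iff (hne : p ≠ q) (a b : V) :
    (G ⊔ SimpleGraph.edge p q).Adj a b ↔ G.Adj a b ∨ (a = p ∧ b = q) ∨ (a = q ∧ b = p) := by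
  rw [SimpleGraph.sup_adj, SimpleGraph.edge_adj]
  grind

end AddEdge

namespace Suppressible

variable {x p q : V} (h : Suppressible G S x p q)

include h

lemma ne_left : x ≠ p := h.adj_left.ne
lemma ne_right : x ≠ q := h.adj_right.ne

lemma eb_singleton_eq {B : Finset V} (hB : B ⊆ S) :
    eb G {x} B = (if p ∈ B then 1 else 0) + if q ∈ B then 1 else 0 := by
  have : B.filter (G.Adj x) = B.filter (p = ·) ∪ B.filter (q = ·) := by
    ext w
    simp only [Finset.mem_filter, Finset.mem_union]
    constructor
    · rintro ⟨hw, ha⟩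
      rcases h.eq_or w (hB hw) ha with rfl | rfl <;> simp [hw]
    · rintro (⟨hw, rfl⟩ | ⟨hw, rfl⟩)
      exacts [⟨hw, h.adj_left⟩, ⟨hw, h.adj_right⟩]
  rw [eb_singleton, this, Finset.card_union_of_disjoint, Finset.filter_eq, Finset.filter_eq]
  · split_ifs <;> simp
  · refine Finset.disjoint_filter.mpr fun w _ h1 h2 => h.ne (h1.trans h2.symm)

lemma frustLE {k : ℕ}
    (hk : FrustLE (G ⊔ SimpleGraph.edge p q)
      (Function.update σ s(p, q) (xor (σ s(x, p)) (σ s(x, q)))) (S.erase x) k) :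
    FrustLE G σ S k := by
  obtain ⟨c, hc⟩ := hk
  have hp : p ∈ S.erase x := Finset.mem_erase.mpr ⟨h.ne_left.symm, h.mem_left⟩
  have hq : q ∈ S.erase x := Finset.mem_erase.mpr ⟨h.ne_right.symm, h.mem_right⟩
  rw [bd_add_edge h.not_adj h.ne (sup_edge_adj_iff h.ne) _ _ _ hp hq] at hc
  let c' : V → Bool := Function.update c x (xor (σ s(x, p)) (c p))
  have hx : c' x = xor (σ s(x, p)) (c p) := by simp [c']
  have hne : ∀ w, w ≠ x → c' w = c w := fun w hw => by simp [c', hw]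
  have hS : S = S.erase x ∪ {x} := by
    rw [Finset.union_comm, ← Finset.insert_eq, Finset.insert_erase h.mem]
  refine ⟨c', ?_⟩
  rw [hS, bd_union_self G σ c' (by simp)]
  have h1 : bd G σ c' (S.erase x) (S.erase x) = bd G σ c (S.erase x) (S.erase x) :=
    bd_congr _ (fun a ha => hne a (Finset.ne_of_mem_erase ha))
      (fun a ha => hne a (Finset.ne_of_mem_erase ha))
  have h2 : bd G σ c' {x} {x} = 0 := by simp [bd]
  have h3 : bd G σ c' (S.erase x) {x} ≤
      if xor (σ s(x, p)) (σ s(x, q)) ≠ xor (c p) (c q) then 1 else 0 := by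
    unfold bd
    simp only [Finset.sum_singleton]
    refine (Finset.sum_le_sum (g := fun a => if q = a then
      (if xor (σ s(x, p)) (σ s(x, q)) ≠ xor (c p) (c q) then 1 else 0) else 0) fun a ha => ?_).trans
      (by simp [Finset.sum_ite_eq, hq])
    obtain ⟨hax, haS⟩ := Finset.mem_erase.mp ha
    by_cases hadj : G.Adj a x
    · rcases h.eq_or a haS hadj.symm with rfl | rfl
      · rw [hx, hne _ hax, Sym2.eq_swap (a := a)]
        cases σ s(x, a) <;> cases c a <;> simp
      · rw [hx, hne _ hax, Sym2.eq_swap (a := a)]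
        simp only [hadj, true_and, if_true]
        cases σ s(x, p) <;> cases σ s(x, a) <;> cases c p <;> cases c a <;> simp
    · simp [hadj]
  rw [h1, h2]
  omega

lemma eb_erase {v : V} (hv : v ∈ S.erase x) :
    eb (G ⊔ SimpleGraph.edge p q) {v} (S.erase x) = eb G {v} S := by
  obtain ⟨hvx, hvS⟩ := Finset.mem_erase.mp hv
  have hp : p ∈ S.erase x := Finset.mem_erase.mpr ⟨h.ne_left.symm, h.mem_left⟩
  have hq : q ∈ S.erase x := Finset.mem_erase.mpr ⟨h.ne_right.symm, h.mem_right⟩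
  have e : S \ S.erase x = {x} := by
    ext w; by_cases hw : w = x <;> simp_all [h.mem]
  rw [eb_add_edge h.not_adj h.ne (sup_edge_adj_iff h.ne),
    eb_split_right G (Finset.erase_subset x S), e, eb_comm G {v} {x},
    h.eb_singleton_eq (Finset.singleton_subset_iff.mpr hvS)]
  simp [hp, hq]

lemma twoConnOn (hS : TwoConnOn G S) : TwoConnOn (G ⊔ SimpleGraph.edge p q) (S.erase x) := by
  intro X hX hXn hXS
  have hp : p ∈ S.erase x := Finset.mem_erase.mpr ⟨h.ne_left.symm, h.mem_left⟩
  have hq : q ∈ S.erase x := Finset.mem_erase.mpr ⟨h.ne_right.symm, h.mem_right⟩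
  have hxX : x ∉ X := fun hx => by simpa using hX hx
  have hXS' : X ⊆ S := hX.trans (Finset.erase_subset _ _)
  have h1 := hS X hXS' hXn (fun e => hxX (e ▸ h.mem))
  have h2 := hS (insert x X) (Finset.insert_subset h.mem hXS') (Finset.insert_nonempty _ _)
    (fun e => hXS (by rw [← e, Finset.erase_insert hxX]))
  rw [eb_add_edge h.not_adj h.ne (sup_edge_adj_iff h.ne)]
  have e1 : S \ X = (S.erase x \ X) ∪ {x} := by
    ext w; by_cases hw : w = x <;> simp_all [h.mem]
  have e2 : S \ insert x X = S.erase x \ X := by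
    ext w; by_cases hw : w = x <;> simp_all
  rw [e1, eb_union_right G _ (by simp), eb_comm G X {x}, h.eb_singleton_eq hXS'] at h1
  rw [e2, Finset.insert_eq, eb_union_left G (by simpa using hxX),
    h.eb_singleton_eq (Finset.sdiff_subset.trans (Finset.erase_subset _ _))] at h2
  simp only [Finset.mem_sdiff, hp, hq, true_and] at h1 h2 ⊢
  by_cases a : p ∈ X <;> by_cases b : q ∈ X <;> simp_all

end Suppressible

end

section

variable {V : Type*} {G : SimpleGraph V} {σ : Sym2 V → Bool} {S : Finset V}

lemma eb_erase_add {y : V} (hy : y ∈ S) (A : Finset V) :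
    eb G A (S.erase y) + eb G A {y} = eb G A S := by
  rw [← eb_union_right G A (by simp), Finset.union_comm, ← Finset.insert_eq,
    Finset.insert_erase hy]

lemma eb_pos_of_adj {a b : V} {A B : Finset V} (ha : a ∈ A) (hb : b ∈ B) (h : G.Adj a b) :
    1 ≤ eb G A B := (eb_pos_iff G A B).mpr ⟨a, ha, b, hb, h⟩

lemma card_le_eb_singleton {v : V} {B T : Finset V} (hT : ∀ w ∈ T, w ∈ B ∧ G.Adj v w) :
    T.card ≤ eb G {v} B := by
  rw [eb_singleton]
  exact Finset.card_le_card fun w hw => by simpa using hT w hw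

lemma two_le_eb_singleton {v a b : V} {B : Finset V} (hab : a ≠ b) (ha : a ∈ B) (hb : b ∈ B)
    (hva : G.Adj v a) (hvb : G.Adj v b) : 2 ≤ eb G {v} B := by
  rw [← Finset.card_pair hab]
  refine card_le_eb_singleton fun w hw => ?_
  simp only [Finset.mem_insert, Finset.mem_singleton] at hw
  rcases hw with rfl | rfl
  exacts [⟨ha, hva⟩, ⟨hb, hvb⟩]

lemma three_le_eb_singleton {v a b c : V} {B : Finset V} (hab : a ≠ b) (hac : a ≠ c) (hbc : b ≠ c)
    (ha : a ∈ B) (hb : b ∈ B) (hc : c ∈ B) (hva : G.Adj v a) (hvb : G.Adj v b)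
    (hvc : G.Adj v c) : 3 ≤ eb G {v} B := by
  have h3 : ({a, b, c} : Finset V).card = 3 :=
    Finset.card_eq_three.mpr ⟨a, b, c, hab, hac, hbc, rfl⟩
  rw [← h3]
  refine card_le_eb_singleton fun w hw => ?_
  simp only [Finset.mem_insert, Finset.mem_singleton] at hw
  rcases hw with rfl | rfl | rfl
  exacts [⟨ha, hva⟩, ⟨hb, hvb⟩, ⟨hc, hvc⟩]

lemma eq_of_eb_singleton_le_one {v a b : V} {B : Finset V} (h : eb G {v} B ≤ 1) (ha : a ∈ B)
    (hb : b ∈ B) (hva : G.Adj v a) (hvb : G.Adj v b) : a = b := by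
  by_contra hab
  have := two_le_eb_singleton hab ha hb hva hvb
  omega

/-- The two neighbours of a vertex of degree two. -/
lemma exists_pair_of_eb_eq_two {x : V} {B : Finset V} (h : eb G {x} B = 2) :
    ∃ p q, p ≠ q ∧ p ∈ B ∧ q ∈ B ∧ G.Adj x p ∧ G.Adj x q ∧
      ∀ w ∈ B, G.Adj x w → w = p ∨ w = q := by
  rw [eb_singleton] at h
  obtain ⟨p, q, hpq, e⟩ := Finset.card_eq_two.mp h
  have : ∀ w, w ∈ B ∧ G.Adj x w ↔ w = p ∨ w = q := fun w => by
    rw [← Finset.mem_filter, e]; simp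
  exact ⟨p, q, hpq, ((this p).mpr (Or.inl rfl)).1, ((this q).mpr (Or.inr rfl)).1,
    ((this p).mpr (Or.inl rfl)).2, ((this q).mpr (Or.inr rfl)).2,
    fun w hw hx => (this w).mp ⟨hw, hx⟩⟩

/-- The three neighbours of a vertex of degree three. -/
lemma exists_triple_of_eb_eq_three {x : V} {B : Finset V} (h : eb G {x} B = 3) :
    ∃ p q r, p ≠ q ∧ p ≠ r ∧ q ≠ r ∧ p ∈ B ∧ q ∈ B ∧ r ∈ B ∧ G.Adj x p ∧ G.Adj x q ∧ G.Adj x r ∧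
      ∀ w ∈ B, G.Adj x w → w = p ∨ w = q ∨ w = r := by
  rw [eb_singleton] at h
  obtain ⟨p, q, r, hpq, hpr, hqr, e⟩ := Finset.card_eq_three.mp h
  have : ∀ w, w ∈ B ∧ G.Adj x w ↔ w = p ∨ w = q ∨ w = r := fun w => by
    rw [← Finset.mem_filter, e]; simp
  have hp := (this p).mpr (by simp)
  have hq := (this q).mpr (by simp)
  have hr := (this r).mpr (by simp)
  exact ⟨p, q, r, hpq, hpr, hqr, hp.1, hq.1, hr.1, hp.2, hq.2, hr.2,
    fun w hw hx => (this w).mp ⟨hw, hx⟩⟩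

lemma eb_sdiff_comm {X : Finset V} (hX : X ⊆ S) :
    eb G (S \ X) (S \ (S \ X)) = eb G X (S \ X) := by
  rw [Finset.sdiff_sdiff_eq_self hX, eb_comm]

/-- Submodularity of the cut function. -/
lemma eb_inter_add_eb_union_le {A B : Finset V} (hA : A ⊆ S) (hB : B ⊆ S) :
    eb G (A ∩ B) (S \ (A ∩ B)) + eb G (A ∪ B) (S \ (A ∪ B)) ≤
      eb G A (S \ A) + eb G B (S \ B) := by
  let P := A ∩ B
  let Q := A \ B
  let R := B \ A
  let T := S \ (A ∪ B)
  have hPQ : Disjoint P Q := by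
    rw [Finset.disjoint_left]; simp only [P, Q, Finset.mem_inter, Finset.mem_sdiff]; tauto
  have hPR : Disjoint P R := by
    rw [Finset.disjoint_left]; simp only [P, R, Finset.mem_inter, Finset.mem_sdiff]; tauto
  have hQR : Disjoint Q R := by
    rw [Finset.disjoint_left]; simp only [Q, R, Finset.mem_sdiff]; tauto
  have hQT : Disjoint Q T := by
    rw [Finset.disjoint_left]; simp only [Q, T, Finset.mem_sdiff, Finset.mem_union]; tauto
  have hRT : Disjoint R T := by
    rw [Finset.disjoint_left]; simp only [R, T, Finset.mem_sdiff, Finset.mem_union]; tauto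
  have eA : A = P ∪ Q := by
    ext w
    simp only [P, Q, Finset.mem_union, Finset.mem_inter, Finset.mem_sdiff]
    tauto
  have eB : B = P ∪ R := by
    ext w
    simp only [P, R, Finset.mem_union, Finset.mem_inter, Finset.mem_sdiff]
    tauto
  have eAc : S \ A = R ∪ T := by
    ext w
    have := @hA w; have := @hB w
    simp only [R, T, Finset.mem_union, Finset.mem_sdiff]; tauto
  have eBc : S \ B = Q ∪ T := by
    ext w
    have := @hA w; have := @hB w
    simp only [Q, T, Finset.mem_union, Finset.mem_sdiff]; tauto
  have ePc : S \ (A ∩ B) = (Q ∪ R) ∪ T := by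
    ext w
    have := @hA w; have := @hB w
    simp only [Q, R, T, Finset.mem_union, Finset.mem_sdiff, Finset.mem_inter]; tauto
  have eU : A ∪ B = (P ∪ Q) ∪ R := by
    ext w
    simp only [P, Q, R, Finset.mem_union, Finset.mem_sdiff, Finset.mem_inter]; tauto
  have h1 : eb G (A ∩ B) (S \ (A ∩ B)) = eb G P Q + eb G P R + eb G P T := by
    rw [ePc, eb_union_right, eb_union_right _ _ hQR]
    exact Finset.disjoint_union_left.mpr ⟨hQT, hRT⟩
  have h2 : eb G (A ∪ B) (S \ (A ∪ B)) = eb G P T + eb G Q T + eb G R T := by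
    change eb G (A ∪ B) T = _
    rw [eU, eb_union_left, eb_union_left _ hPQ]
    exact Finset.disjoint_union_left.mpr ⟨hPR, hQR⟩
  have h3 : eb G A (S \ A) = eb G P R + eb G P T + (eb G Q R + eb G Q T) := by
    rw [eAc, eb_union_right _ _ hRT, eA, eb_union_left _ hPQ, eb_union_left _ hPQ]; ring
  have h4 : eb G B (S \ B) = eb G P Q + eb G P T + (eb G R Q + eb G R T) := by
    rw [eBc, eb_union_right _ _ hQT, eB, eb_union_left _ hPR, eb_union_left _ hPR]; ring
  omega

end

section

variable {V : Type*} {G : SimpleGraph V} {σ : Sym2 V → Bool} {S : Finset V}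

/-- The shapes of the signed graphs for which the bound of one third fails, with their
frustration indices. -/
def Exceptional (G : SimpleGraph V) (S : Finset V) (k : ℕ) : Prop :=
  (S.card = 4 ∧ (∀ v ∈ S, eb G {v} S = 3) ∧ k = 2) ∨
  (S.card = 5 ∧ (∀ u ∈ S, ∀ v ∈ S, eb G {u} S ≤ 2 → eb G {v} S ≤ 2 → u = v) ∧ k = 2) ∨
  (S.card = 8 ∧ (∀ v ∈ S, eb G {v} S = 3) ∧ k = 3)

/-- The frustration index of the subgraph induced by `S` is at most a third of the order, unless
`S` has an exceptional shape. -/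
def Bounded (G : SimpleGraph V) (σ : Sym2 V → Bool) (S : Finset V) : Prop :=
  ∃ k, FrustLE G σ S k ∧ (3 * k ≤ S.card ∨ Exceptional G S k)

/-- The bound holds for all graphs on fewer than `n` vertices. -/
def BoundedBelow (V : Type*) (n : ℕ) : Prop :=
  ∀ (G : SimpleGraph V) (σ : Sym2 V → Bool) (S : Finset V), S.card < n → TwoConnOn G S →
    (∀ v ∈ S, eb G {v} S ≤ 3) → Bounded G σ S

lemma Bounded.of_two_low {p q : V} (h : Bounded G σ S) (hp : p ∈ S) (hq : q ∈ S) (hpq : p ≠ q)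
    (hdp : eb G {p} S ≤ 2) (hdq : eb G {q} S ≤ 2) : ∃ k, FrustLE G σ S k ∧ 3 * k ≤ S.card := by
  obtain ⟨k, hk, h3 | ⟨-, h3, -⟩ | ⟨-, h3, -⟩ | ⟨-, h3, -⟩⟩ := h
  · exact ⟨k, hk, h3⟩
  · have := h3 p hp; omega
  · exact absurd (h3 p hp q hq hdp hdq) hpq
  · have := h3 p hp; omega

/-- A chain of 2-edge-connected pieces leading from `p` to `q`: adding the edge `pq` would make
the graph induced by `H` 2-edge-connected and subcubic. -/
structure IsChain (G : SimpleGraph V) (H : Finset V) (p q : V) : Prop where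
  mem_left : p ∈ H
  mem_right : q ∈ H
  one_le : ∀ W ⊆ H, W.Nonempty → W ≠ H → 1 ≤ eb G W (H \ W)
  two_le : ∀ W ⊆ H, W.Nonempty → W ≠ H → (p ∈ W ↔ q ∈ W) → 2 ≤ eb G W (H \ W)
  deg_le : ∀ v ∈ H, eb G {v} H ≤ 3
  deg_left : eb G {p} H ≤ 2
  deg_right : eb G {q} H ≤ 2
  deg_eq : p = q → eb G {p} H ≤ 1

namespace IsChain

variable {H W : Finset V} {p q r s : V}

lemma symm (h : IsChain G H p q) : IsChain G H q p where
  mem_left := h.mem_right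
  mem_right := h.mem_left
  one_le := h.one_le
  two_le W hW hn hne hpq := h.two_le W hW hn hne hpq.symm
  deg_le := h.deg_le
  deg_left := h.deg_right
  deg_right := h.deg_left
  deg_eq e := e ▸ h.deg_eq e.symm

/-- Cutting a chain at a bridge gives a shorter chain. -/
lemma cut (h : IsChain G H p q) (hW : W ⊆ H) (hp : p ∈ W) (hq : q ∉ W) (h1 : eb G W (H \ W) ≤ 1)
    (hr : r ∈ W) (hs : s ∈ H \ W) (hrs : G.Adj r s) : IsChain G W p r := by
  have hr1 : 1 ≤ eb G {r} (H \ W) := eb_pos_of_adj (Finset.mem_singleton_self r) hs hrs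
  have hdeg : ∀ v, eb G {v} W + eb G {v} (H \ W) = eb G {v} H := fun v =>
    (eb_split_right G hW _).symm
  have key : ∀ U ⊆ W, r ∉ U → eb G U (H \ U) = eb G U (W \ U) := by
    intro U hU hrU
    have e : H \ U = (W \ U) ∪ (H \ W) := by
      ext w
      have := @hU w; have := @hW w
      simp only [Finset.mem_union, Finset.mem_sdiff]; tauto
    have hd : Disjoint (W \ U) (H \ W) := by
      rw [Finset.disjoint_left]; simp only [Finset.mem_sdiff]; tauto
    have h2 := eb_mono_left G (Finset.union_subset hU (Finset.singleton_subset_iff.mpr hr)) (H \ W)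
    rw [eb_union_left G (by simpa using hrU)] at h2
    rw [e, eb_union_right G _ hd]
    omega
  have sub : ∀ U ⊆ W, U.Nonempty → U ≠ W →
      (∃ U' ⊆ W, U'.Nonempty ∧ U' ≠ H ∧ r ∉ U' ∧ q ∉ U' ∧ eb G U' (H \ U') = eb G U (W \ U) ∧
        ((p ∈ U ↔ r ∈ U) → p ∉ U')) := by
    intro U hU hn hne
    by_cases hrU : r ∈ U
    · refine ⟨W \ U, Finset.sdiff_subset, ?_, ?_, by simp [hrU], by simp [hq], ?_, ?_⟩
      · exact Finset.sdiff_nonempty.mpr fun h' => hne (hU.antisymm h')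
      · intro e
        have := e ▸ h.mem_right
        simp [hq] at this
      · rw [key _ Finset.sdiff_subset (by simp [hrU]), eb_sdiff_comm hU]
      · intro hpr
        simp [hpr.mpr hrU]
    · refine ⟨U, hU, hn, ?_, hrU, fun h' => hq (hU h'), key U hU hrU, ?_⟩
      · rintro rfl
        exact hq (hU h.mem_right)
      · intro hpr
        simp [hpr, hrU]
  refine ⟨hp, hr, ?_, ?_, fun v hv => ?_, ?_, ?_, ?_⟩
  · intro U hU hn hne
    obtain ⟨U', hU', hn', hne', -, -, e, -⟩ := sub U hU hn hne
    exact e ▸ h.one_le U' (hU'.trans hW) hn' hne'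
  · intro U hU hn hne hpr
    obtain ⟨U', hU', hn', hne', -, hq', e, hp'⟩ := sub U hU hn hne
    exact e ▸ h.two_le U' (hU'.trans hW) hn' hne' (iff_of_false (hp' hpr) hq')
  · have := hdeg v; have := h.deg_le v (hW hv); omega
  · have := hdeg p; have := h.deg_left; omega
  · have := hdeg r; have := h.deg_le r (hW hr); omega
  · rintro rfl
    have := hdeg p; have := h.deg_left; omega

/-- A chain shorter than `n` satisfies the bound if all smaller graphs do. -/
theorem exists_frustLE {n : ℕ} (ih : BoundedBelow V n) (h : IsChain G H p q) (hn : H.card < n) :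
    ∃ k, FrustLE G σ H k ∧ 3 * k ≤ H.card := by
  induction hm : H.card using Nat.strong_induction_on generalizing H p q with
  | _ m ihm =>
  by_cases hpq : p = q
  · have hH : H = {p} := by
      by_contra hne
      have h2 := h.two_le {p} (Finset.singleton_subset_iff.mpr h.mem_left) (by simp)
        (Ne.symm hne) (by simp [hpq])
      have := h.deg_eq hpq
      have := eb_mono_right G {p} (Finset.sdiff_subset (s := H) (t := {p}))
      omega
    exact ⟨0, hH ▸ frustLE_singleton p, by omega⟩
  by_cases hc : TwoConnOn G H
  · rw [← hm]
    exact (ih G σ H hn hc h.deg_le).of_two_low h.mem_left h.mem_right hpq h.deg_left h.deg_right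
  have : ∃ W ⊆ H, p ∈ W ∧ q ∉ W ∧ eb G W (H \ W) ≤ 1 := by
    unfold TwoConnOn at hc
    push Not at hc
    obtain ⟨W, hW, hWn, hWH, hlt⟩ := hc
    by_cases hp : p ∈ W
    · refine ⟨W, hW, hp, fun hq => ?_, by omega⟩
      have := h.two_le W hW hWn hWH (by simp [hp, hq])
      omega
    · refine ⟨H \ W, Finset.sdiff_subset, by simp [hp, h.mem_left], fun hq => ?_, ?_⟩
      · have := h.two_le W hW hWn hWH (by simp_all)
        omega
      · rw [eb_sdiff_comm hW]; omega
  obtain ⟨W, hW, hp, hq, h1⟩ := this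
  have hWH : W ≠ H := fun e => hq (e ▸ h.mem_right)
  have hqZ : q ∈ H \ W := Finset.mem_sdiff.mpr ⟨h.mem_right, hq⟩
  obtain ⟨r, hr, s, hs, hrs⟩ := (eb_pos_iff G W (H \ W)).mp (h.one_le W hW ⟨p, hp⟩ hWH)
  have c1 := h.cut hW hp hq h1 hr hs hrs
  have c2 := h.symm.cut Finset.sdiff_subset hqZ (by simp [hp]) (by rwa [eb_sdiff_comm hW]) hs
    (by rwa [Finset.sdiff_sdiff_eq_self hW]) hrs.symm
  have hcard := Finset.card_sdiff_add_card_eq_card hW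
  have hW0 := Finset.card_pos.mpr ⟨p, hp⟩
  have hZ0 := Finset.card_pos.mpr ⟨q, hqZ⟩
  obtain ⟨k, hk, hk3⟩ := ihm W.card (by omega) c1 (by omega) rfl
  obtain ⟨l, hl, hl3⟩ := ihm (H \ W).card (by omega) c2 (by omega) rfl
  refine ⟨k + l, ?_, by omega⟩
  have := hk.union hl Finset.disjoint_sdiff (m := 0) (by omega)
  rwa [Finset.union_sdiff_of_subset hW] at this

end IsChain

/-- The bound follows by suppression at a vertex of degree two not in a triangle. -/
lemma bounded_of_suppressible {x y z : V} (ih : BoundedBelow V S.card) (hS : TwoConnOn G S)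
    (hdeg : ∀ v ∈ S, eb G {v} S ≤ 3) (h : Suppressible G S x y z) : Bounded G σ S := by
  have hcard := Finset.card_erase_add_one h.mem
  obtain ⟨k, hk, h3⟩ := ih _ (Function.update σ s(y, z) (xor (σ s(x, y)) (σ s(x, z)))) _
    (by omega) (h.twoConnOn hS)
    (fun v hv => (h.eb_erase hv).trans_le (hdeg v (Finset.mem_of_mem_erase hv)))
  refine ⟨k, h.frustLE hk, ?_⟩
  rcases h3 with h3 | ⟨h4, hc, rfl⟩ | ⟨h5, -, rfl⟩ | ⟨h8, -, rfl⟩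
  · left; omega
  · right; right; left
    have hx : ∀ u ∈ S, eb G {u} S ≤ 2 → u = x := by
      intro u hu hu2
      by_contra hne
      have hu' := Finset.mem_erase.mpr ⟨hne, hu⟩
      have := hc u hu'
      rw [h.eb_erase hu'] at this
      omega
    exact ⟨by omega, fun u hu v hv h1 h2 => (hx u hu h1).trans (hx v hv h2).symm, rfl⟩
  · left; omega
  · left; omega

/-- The bound follows by deletion of a triangle through a vertex of degree two. -/
lemma bounded_of_triangle {x y z : V} (ih : BoundedBelow V S.card) (hS : TwoConnOn G S)
    (hdeg : ∀ v ∈ S, eb G {v} S ≤ 3) (hx : x ∈ S) (hy : y ∈ S) (hz : z ∈ S) (hxy : G.Adj x y)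
    (hxz : G.Adj x z) (hyz : G.Adj y z) (hnx : ∀ w ∈ S, G.Adj x w → w = y ∨ w = z) :
    Bounded G σ S := by
  have hx1 : x ∈ S.erase y := Finset.mem_erase.mpr ⟨hxy.ne, hx⟩
  have hz1 : z ∈ S.erase y := Finset.mem_erase.mpr ⟨hyz.ne', hz⟩
  have hz2 : z ∈ (S.erase y).erase x := Finset.mem_erase.mpr ⟨hxz.ne', hz1⟩
  set H := ((S.erase y).erase x).erase z with hH
  have hmem : ∀ w, w ∈ H ↔ w ≠ z ∧ w ≠ x ∧ w ≠ y ∧ w ∈ S := fun w => by simp [hH]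
  have hHS : H ⊆ S := fun w hw => ((hmem w).mp hw).2.2.2
  have split : ∀ A, eb G A S = eb G A H + eb G A {x} + eb G A {y} + eb G A {z} := fun A => by
    rw [← eb_erase_add hy, ← eb_erase_add hx1, ← eb_erase_add hz2]; ring
  have hcard : H.card + 3 = S.card := by
    have h1 := Finset.card_erase_add_one hy
    have h2 := Finset.card_erase_add_one hx1
    have h3 := Finset.card_erase_add_one hz2
    rw [← hH] at h3
    omega
  have one : ∀ {a b : V}, G.Adj a b → eb G {a} {b} = 1 := fun {a b} h => by
    rw [eb_singleton, Finset.filter_singleton, if_pos h, Finset.card_singleton]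
  have hyH : eb G {y} H ≤ 1 := by
    have := split {y}
    rw [one hxy.symm, one hyz] at this
    have := hdeg y hy
    omega
  have hzH : eb G {z} H ≤ 1 := by
    have := split {z}
    rw [one hxz.symm, one hyz.symm] at this
    have := hdeg z hz
    omega
  have hxH : ∀ W ⊆ H, eb G W {x} = 0 := by
    intro W hW
    rw [eb_eq_zero_iff]
    intro a ha b hb hab
    rw [Finset.mem_singleton.mp hb] at hab
    obtain ⟨haz, -, hay, haS⟩ := (hmem a).mp (hW ha)
    rcases hnx a haS hab.symm with h | h
    exacts [hay h, haz h]
  have up : ∀ k, FrustLE G σ H k → FrustLE G σ S (k + 1) := by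
    intro k hk
    have h1 : FrustLE G σ ((S.erase y).erase x) (k + 0) := by
      refine hk.insert hz2 ?_
      rw [← eb_erase_add hz2, eb_self_singleton]
      exact hzH
    have h2 : FrustLE G σ (S.erase y) (k + 0 + 0) := by
      refine h1.insert hx1 ?_
      rw [← eb_erase_add hx1, ← eb_erase_add hz2, eb_self_singleton, one hxz, eb_comm,
        hxH _ subset_rfl]
    exact h2.insert hy (hdeg y hy)
  rcases H.eq_empty_or_nonempty with hHe | hHn
  · refine ⟨1, up 0 (hHe ▸ frustLE_empty), Or.inl (by omega)⟩
  have hsdiff : ∀ W ⊆ H, eb G W (S \ W) = eb G W (H \ W) + eb G W {y} + eb G W {z} := by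
    intro W hW
    have h1 := eb_split_right G (hW.trans hHS) W
    have h2 := eb_split_right G hW W
    have h3 := split W
    have h4 := hxH W hW
    omega
  have hHy := eb_comm G {y} H
  have hHz := eb_comm G {z} H
  have htot : 2 ≤ eb G H {y} + eb G H {z} := by
    have h1 := hS H hHS hHn (fun e => by have := (hmem x).mp (e ▸ hx); simp at this)
    rw [hsdiff H subset_rfl, Finset.sdiff_self, eb_comm, eb_empty_left] at h1
    omega
  obtain ⟨y', hy', b, hb, hyy'⟩ := (eb_pos_iff G H {y}).mp (by omega)
  obtain ⟨z', hz', b', hb', hzz'⟩ := (eb_pos_iff G H {z}).mp (by omega)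
  rw [Finset.mem_singleton] at hb hb'
  subst hb hb'
  have hWy : ∀ W ⊆ H, y' ∉ W → eb G W {b} = 0 := by
    intro W hW hyW
    rw [eb_eq_zero_iff]
    intro a ha c hc hac
    rw [Finset.mem_singleton.mp hc] at hac
    exact hyW (eq_of_eb_singleton_le_one hyH hy' (hW ha) hyy'.symm hac.symm ▸ ha)
  have hWz : ∀ W ⊆ H, z' ∉ W → eb G W {b'} = 0 := by
    intro W hW hzW
    rw [eb_eq_zero_iff]
    intro a ha c hc hac
    rw [Finset.mem_singleton.mp hc] at hac
    exact hzW (eq_of_eb_singleton_le_one hzH hz' (hW ha) hzz'.symm hac.symm ▸ ha)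
  have hWy1 : ∀ W ⊆ H, eb G W {b} ≤ 1 := fun W hW => by
    have := eb_mono_left G hW {b}; omega
  have hWz1 : ∀ W ⊆ H, eb G W {b'} ≤ 1 := fun W hW => by
    have := eb_mono_left G hW {b'}; omega
  have hout : ∀ W ⊆ H, W.Nonempty → y' ∉ W → z' ∉ W → 2 ≤ eb G W (H \ W) := by
    intro W hW hn h1 h2
    have := hS W (hW.trans hHS) hn (fun e => by have := (hmem x).mp (hW (e ▸ hx)); simp at this)
    rw [hsdiff W hW, hWy W hW h1, hWz W hW h2] at this
    omega
  have hchain : IsChain G H y' z' := by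
    refine ⟨hy', hz', ?_, ?_, ?_, ?_, ?_, ?_⟩
    · intro W hW hn hne
      by_cases h1 : y' ∈ W
      · by_cases h2 : z' ∈ W
        · have h3 := hout (H \ W) Finset.sdiff_subset
            (Finset.sdiff_nonempty.mpr fun h' => hne (hW.antisymm h')) (by simp [h1]) (by simp [h2])
          rw [eb_sdiff_comm hW] at h3
          omega
        · have := hS W (hW.trans hHS) hn
            (fun e => by have := (hmem x).mp (hW (e ▸ hx)); simp at this)
          rw [hsdiff W hW, hWz W hW h2] at this
          have := hWy1 W hW
          omega
      · have := hS W (hW.trans hHS) hn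
          (fun e => by have := (hmem x).mp (hW (e ▸ hx)); simp at this)
        rw [hsdiff W hW, hWy W hW h1] at this
        have := hWz1 W hW
        omega
    · intro W hW hn hne hiff
      by_cases h1 : y' ∈ W
      · have h3 := hout (H \ W) Finset.sdiff_subset
          (Finset.sdiff_nonempty.mpr fun h' => hne (hW.antisymm h')) (by simp [h1])
          (by simp [hiff.mp h1])
        rwa [eb_sdiff_comm hW] at h3
      · exact hout W hW hn h1 (fun h2 => h1 (hiff.mpr h2))
    · intro v hv
      exact (eb_mono_right G _ hHS).trans (hdeg v (hHS hv))
    · have h1 := split {y'}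
      rw [one hyy'] at h1
      have h2 := hdeg y' (hHS hy')
      omega
    · have h1 := split {z'}
      rw [one hzz'] at h1
      have h2 := hdeg z' (hHS hz')
      omega
    · rintro rfl
      have h1 := split {y'}
      rw [one hzz', one hyy'] at h1
      have h2 := hdeg y' (hHS hy')
      omega
  obtain ⟨k, hk, hk3⟩ := hchain.exists_frustLE ih (by omega)
  exact ⟨k + 1, up k hk, Or.inl (by omega)⟩

/-- The inductive step for graphs having a vertex of degree at most two. -/
theorem bounded_of_deg_le_two {x : V} (ih : BoundedBelow V S.card) (hS : TwoConnOn G S)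
    (hdeg : ∀ v ∈ S, eb G {v} S ≤ 3) (hx : x ∈ S) (hx2 : eb G {x} S ≤ 2) : Bounded G σ S := by
  by_cases hS1 : S = {x}
  · exact ⟨0, hS1 ▸ frustLE_singleton x, Or.inl (by omega)⟩
  have h2 : eb G {x} S = 2 := by
    have h1 := hS {x} (Finset.singleton_subset_iff.mpr hx) (by simp) (Ne.symm hS1)
    have := eb_mono_right G {x} (Finset.sdiff_subset (s := S) (t := {x}))
    omega
  obtain ⟨y, z, hyz, hy, hz, hxy, hxz, hn⟩ := exists_pair_of_eb_eq_two h2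
  by_cases hadj : G.Adj y z
  · exact bounded_of_triangle ih hS hdeg hx hy hz hxy hxz hadj hn
  · exact bounded_of_suppressible ih hS hdeg ⟨hx, hy, hz, hyz, hxy, hxz, hadj, hn⟩

end

section

variable {V : Type*} {G : SimpleGraph V} {σ : Sym2 V → Bool} {S X : Finset V}

lemma exists_other_two {x a : V} (h : eb G {x} S = 3) (ha : a ∈ S) (hxa : G.Adj x a) :
    ∃ p q, p ≠ q ∧ p ≠ a ∧ q ≠ a ∧ p ∈ S ∧ q ∈ S ∧ G.Adj x p ∧ G.Adj x q ∧
      ∀ w ∈ S, G.Adj x w → w = a ∨ w = p ∨ w = q := by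
  obtain ⟨p, q, r, hpq, hpr, hqr, hp, hq, hr, hxp, hxq, hxr, hn⟩ := exists_triple_of_eb_eq_three h
  rcases hn a ha hxa with rfl | rfl | rfl
  · exact ⟨q, r, hqr, hpq.symm, hpr.symm, hq, hr, hxq, hxr, hn⟩
  · exact ⟨p, r, hpr, hpq, hqr.symm, hp, hr, hxp, hxr, fun w hw h => by grind⟩
  · exact ⟨p, q, hpq, hpr, hqr, hp, hq, hxp, hxq, fun w hw h => by grind⟩

lemma exists_third {x a b : V} (h : eb G {x} S = 3) (hab : a ≠ b) (ha : a ∈ S) (hb : b ∈ S)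
    (hxa : G.Adj x a) (hxb : G.Adj x b) :
    ∃ s, s ≠ a ∧ s ≠ b ∧ s ∈ S ∧ G.Adj x s ∧ ∀ w ∈ S, G.Adj x w → w = a ∨ w = b ∨ w = s := by
  obtain ⟨p, q, hpq, hpa, hqa, hp, hq, hxp, hxq, hn⟩ := exists_other_two h ha hxa
  rcases hn b hb hxb with rfl | rfl | rfl
  · exact absurd rfl hab
  · exact ⟨q, hqa, hpq.symm, hq, hxq, hn⟩
  · exact ⟨p, hpa, hpq, hp, hxp, fun w hw h => by grind⟩

/-- A set of vertices with at most one edge leaving it is everything. -/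
lemma card_le_of_three_le_eb {T : Finset V} {s : V} (hS : TwoConnOn G S)
    (hcub : ∀ v ∈ S, eb G {v} S = 3) (hT : T ⊆ S) (hs : s ∈ T)
    (h3 : ∀ v ∈ T, v ≠ s → 3 ≤ eb G {v} T) (h2 : 2 ≤ eb G {s} T) : S.card ≤ T.card := by
  by_contra hlt
  have h := hS T hT ⟨s, hs⟩ (fun e => hlt (e ▸ le_rfl))
  have hd : ∀ v ∈ T, eb G {v} T + eb G {v} (S \ T) = 3 := fun v hv => by
    rw [← hcub v (hT hv), ← eb_split_right G hT]
  rw [eb_eq_sum, ← Finset.add_sum_erase _ _ hs, Finset.sum_eq_zero] at h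
  · have := hd s hs; omega
  · intro v hv
    obtain ⟨hvs, hvT⟩ := Finset.mem_erase.mp hv
    have := hd v hvT
    have := h3 v hvT hvs
    omega

/-- An inclusion-minimal set of vertices with at most two edges leaving it. -/
structure IsEnd (G : SimpleGraph V) (S X : Finset V) : Prop where
  sub : X ⊆ S
  nonempty : X.Nonempty
  cut_le : eb G X (S \ X) ≤ 2
  three_le : ∀ Y ⊆ X, Y.Nonempty → Y ≠ X → 3 ≤ eb G Y (S \ Y)

lemma exists_isEnd (hS : S.Nonempty) : ∃ X, IsEnd G S X := by
  have hne : (S.powerset.filter fun X => X.Nonempty ∧ eb G X (S \ X) ≤ 2).Nonempty :=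
    ⟨S, by simp [hS, eb]⟩
  obtain ⟨X, hX, hmin⟩ := Finset.exists_min_image _ Finset.card hne
  simp only [Finset.mem_filter, Finset.mem_powerset] at hX hmin
  refine ⟨X, hX.1, hX.2.1, hX.2.2, fun Y hY hYn hYX => ?_⟩
  by_contra hlt
  have h1 := hmin Y ⟨hY.trans hX.1, hYn, by omega⟩
  exact hYX (Finset.eq_of_subset_of_card_le hY h1)

namespace IsEnd

section

variable (h : IsEnd G S X) (hcub : ∀ v ∈ S, eb G {v} S = 3)

include h hcub

lemma eb_add_eb {a : V} (ha : a ∈ S) : eb G {a} X + eb G {a} (S \ X) = 3 := by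
  rw [← hcub a ha, ← eb_split_right G h.sub]

lemma eb_out_le {a : V} (ha : a ∈ X) : eb G {a} (S \ X) ≤ 1 := by
  by_contra hlt
  have haS := h.sub ha
  have h1 := h.eb_add_eb hcub haS
  by_cases hX : X = {a}
  · have h2 := h.cut_le
    have h3 := h.eb_add_eb hcub haS
    rw [hX, eb_self_singleton] at h3
    rw [hX] at h2
    omega
  · have hn : (X.erase a).Nonempty := by
      rw [Finset.nonempty_iff_ne_empty, Ne, Finset.erase_eq_empty_iff]
      exact fun h' => h'.elim h.nonempty.ne_empty hX
    have h2 := h.three_le (X.erase a) (Finset.erase_subset _ _) hn (Finset.erase_ne_self.mpr ha)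
    have e : S \ X.erase a = (S \ X) ∪ {a} := by
      ext w; by_cases hw : w = a <;> simp_all
    have h3 := eb_split_left G (Finset.singleton_subset_iff.mpr ha) (S \ X)
    rw [e, eb_union_right G _ (by simp [ha]), eb_comm G _ {a}] at h2
    rw [← Finset.erase_eq] at h3
    have h4 := eb_mono_right G {a} (Finset.erase_subset a X)
    have h5 := h.cut_le
    omega

lemma eb_in_le (hS : TwoConnOn G S) {w : V} (hw : w ∈ S \ X) : eb G {w} X ≤ 1 := by
  by_contra hlt
  obtain ⟨hwS, hwX⟩ := Finset.mem_sdiff.mp hw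
  have h1 := h.eb_add_eb hcub hwS
  have h3 := eb_split_left G (Finset.singleton_subset_iff.mpr hw) X
  have h5 := h.cut_le
  rw [eb_comm] at h5
  by_cases hX : X ∪ {w} = S
  · have e : S \ X = {w} := by
      rw [← hX, Finset.union_sdiff_cancel_left]
      simpa using hwX
    rw [e, eb_self_singleton] at h1
    rw [e] at h5
    omega
  · have h2 := hS (X ∪ {w}) (Finset.union_subset h.sub (by simpa using hwS)) (by simp) hX
    have e : S \ (X ∪ {w}) = (S \ X) \ {w} := by
      ext u; simp only [Finset.mem_sdiff, Finset.mem_union]; tauto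
    rw [e, eb_union_left G (by simpa using hwX)] at h2
    have h4 := eb_mono_right G {w} (Finset.sdiff_subset (s := S \ X) (t := {w}))
    rw [eb_comm G X] at h2
    omega

lemma eb_out_eq_zero_of_adj {a b : V} (ha : a ∈ X) (hb : b ∈ X) (hab : G.Adj a b)
    (hout : 1 ≤ eb G {a} (S \ X)) : eb G {b} (S \ X) = 0 := by
  by_contra hb0
  have h1 := h.eb_add_eb hcub (h.sub ha)
  have h2 := h.eb_add_eb hcub (h.sub hb)
  have h3 := h.eb_out_le hcub ha
  have h4 := h.eb_out_le hcub hb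
  have hbX : b ∈ X.erase a := Finset.mem_erase.mpr ⟨hab.ne', hb⟩
  set Y := (X.erase a).erase b with hY
  have hYX : Y ⊆ X := (Finset.erase_subset _ _).trans (Finset.erase_subset _ _)
  have one : eb G {a} {b} = 1 := by
    rw [eb_singleton, Finset.filter_singleton, if_pos hab, Finset.card_singleton]
  have split : ∀ A, eb G A X = eb G A Y + eb G A {b} + eb G A {a} := fun A => by
    rw [← eb_erase_add ha, ← eb_erase_add hbX]
  have h5 := split {a}
  have h6 := split {b}
  rw [eb_self_singleton, one] at h5
  rw [eb_self_singleton, eb_comm G {b} {a}, one] at h6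
  have hYn : Y.Nonempty := by
    rw [Finset.nonempty_iff_ne_empty]
    intro hYe
    rw [hYe, eb_comm G {a} ∅, eb_empty_left] at h5
    omega
  have h7 := h.three_le Y hYX hYn (fun e => by rw [← e] at ha; simp [hY] at ha)
  have e : S \ Y = (S \ X) ∪ {b} ∪ {a} := by
    ext w
    have hbS := h.sub hb
    have haS := h.sub ha
    by_cases hwa : w = a
    · simp [hY, hwa, haS]
    · by_cases hwb : w = b
      · simp [hY, hwb, hbS]
      · simp [hY, hwa, hwb]
  rw [e, eb_union_right G _ (by simp [ha, hab.ne]), eb_union_right G _ (by simp [hb])] at h7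
  have h8 := split (S \ X)
  rw [eb_comm G (S \ X) X, eb_comm G (S \ X) Y, eb_comm G (S \ X) {a}, eb_comm G (S \ X) {b}] at h8
  rw [eb_comm G Y {a}, eb_comm G Y {b}] at h7
  have h9 := h.cut_le
  omega

lemma exists_interior : ∃ v ∈ X, eb G {v} (S \ X) = 0 := by
  obtain ⟨a, ha⟩ := h.nonempty
  by_cases h0 : eb G {a} (S \ X) = 0
  · exact ⟨a, ha, h0⟩
  have h1 := h.eb_add_eb hcub (h.sub ha)
  have h2 := h.eb_out_le hcub ha
  obtain ⟨a', ha', b, hb, hab⟩ := (eb_pos_iff G {a} X).mp (by omega)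
  rw [Finset.mem_singleton] at ha'
  subst ha'
  exact ⟨b, hb, h.eb_out_eq_zero_of_adj hcub ha hb hab (by omega)⟩

/-- Deleting an interior vertex of an end preserves 2-edge-connectivity. -/
lemma twoConnOn_erase (hS : TwoConnOn G S) {v : V} (hv : v ∈ X) (hv0 : eb G {v} (S \ X) = 0) :
    TwoConnOn G (S.erase v) := by
  have hvS := h.sub hv
  have main : ∀ W ⊆ S.erase v, W.Nonempty → eb G {v} W ≤ 1 → 2 ≤ eb G W (S.erase v \ W) := by
    intro W hW hWn hvW
    by_contra hlt
    have hvW' : v ∉ W := fun h' => by simpa using hW h'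
    have hWS : W ⊆ S := hW.trans (Finset.erase_subset _ _)
    have e : S \ W = (S.erase v \ W) ∪ {v} := by
      ext w; by_cases hw : w = v <;> simp_all
    have hd : eb G W (S \ W) = eb G W (S.erase v \ W) + eb G {v} W := by
      rw [e, eb_union_right G _ (by simp), eb_comm G {v}]
    by_cases hXW : (X ∩ W).Nonempty
    · have h3 := h.three_le (X ∩ W) Finset.inter_subset_left hXW
        (fun e => hvW' (Finset.mem_inter.mp (e ▸ hv)).2)
      have hsub := eb_inter_add_eb_union_le (G := G) h.sub hWS
      have hcut := h.cut_le
      have hU : X ∪ W = S := by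
        by_contra hne
        have := hS (X ∪ W) (Finset.union_subset h.sub hWS) (hWn.mono Finset.subset_union_right) hne
        omega
      have hSW : S \ W ⊆ X := by
        rw [← hU]; intro w; simp only [Finset.mem_sdiff, Finset.mem_union]; tauto
      have h4 := h.three_le (S \ W) hSW ⟨v, by simp [hvS, hvW']⟩ (by
        intro e
        obtain ⟨w, hw⟩ := hXW
        rw [← e] at hw
        simp at hw)
      rw [eb_sdiff_comm hWS] at h4
      omega
    · have hWX : W ⊆ S \ X := fun w hw => Finset.mem_sdiff.mpr
        ⟨hWS hw, fun hwX => hXW ⟨w, Finset.mem_inter.mpr ⟨hwX, hw⟩⟩⟩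
      have h1 := eb_mono_right G {v} hWX
      have h2 := hS W hWS hWn (fun e => hvW' (e ▸ hvS))
      omega
  intro W hW hWn hne
  have h3 := hcub v hvS
  rw [← eb_erase_add hvS, eb_self_singleton, eb_split_right G hW] at h3
  by_cases hvW : eb G {v} W ≤ 1
  · exact main W hW hWn hvW
  · have := main (S.erase v \ W) Finset.sdiff_subset
      (Finset.sdiff_nonempty.mpr fun h' => hne (hW.antisymm h')) (by omega)
    rwa [eb_sdiff_comm hW] at this

end

end IsEnd

/-- The bound follows if one neighbour of a deletable vertex keeps degree two and
the other two can be suppressed. -/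
lemma bounded_of_erase_of_suppressible {v x y z p q p' q' : V} (ih : BoundedBelow V S.card)
    (hcub : ∀ v ∈ S, eb G {v} S = 3) (hv : v ∈ S) (hSv : TwoConnOn G (S.erase v))
    (hx : Suppressible G (S.erase v) x p q)
    (hy : Suppressible (G ⊔ SimpleGraph.edge p q) ((S.erase v).erase x) y p' q')
    (hz : z ∈ S) (hvz : G.Adj v z) (hzx : z ≠ x) (hzy : z ≠ y) : Bounded G σ S := by
  have c1 := Finset.card_erase_add_one hv
  have c2 := Finset.card_erase_add_one hx.mem
  have c3 := Finset.card_erase_add_one hy.mem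
  have hz1 : z ∈ S.erase v := Finset.mem_erase.mpr ⟨hvz.ne', hz⟩
  have hz2 : z ∈ (S.erase v).erase x := Finset.mem_erase.mpr ⟨hzx, hz1⟩
  have hz3 : z ∈ ((S.erase v).erase x).erase y := Finset.mem_erase.mpr ⟨hzy, hz2⟩
  have hdeg : ∀ u (hu : u ∈ ((S.erase v).erase x).erase y),
      eb (G ⊔ SimpleGraph.edge p q ⊔ SimpleGraph.edge p' q') {u} (((S.erase v).erase x).erase y) =
        eb G {u} (S.erase v) := fun u hu => by
    rw [hy.eb_erase hu, hx.eb_erase (Finset.mem_of_mem_erase hu)]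
  have hzdeg : eb G {z} (S.erase v) ≤ 2 := by
    have h1 := hcub z hz
    rw [← eb_erase_add hv] at h1
    have := eb_pos_of_adj (Finset.mem_singleton_self z) (Finset.mem_singleton_self v) hvz.symm
    omega
  let σ₁ := Function.update σ s(p, q) (xor (σ s(x, p)) (σ s(x, q)))
  obtain ⟨k, hk, h3⟩ := ih _ (Function.update σ₁ s(p', q') (xor (σ₁ s(y, p')) (σ₁ s(y, q')))) _
    (by omega) (hy.twoConnOn (hx.twoConnOn hSv)) (fun u hu => by
      rw [hdeg u hu]
      have huS := Finset.mem_of_mem_erase (Finset.mem_of_mem_erase (Finset.mem_of_mem_erase hu))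
      exact (eb_mono_right G _ (Finset.erase_subset _ _)).trans (hcub u huS).le)
  have hk1 := (hx.frustLE (hy.frustLE hk)).insert hv (m := 1) (hcub v hv).le
  refine ⟨k + 1, hk1, ?_⟩
  rcases h3 with h3 | ⟨-, h4, -⟩ | ⟨h5, -, rfl⟩ | ⟨-, h8, -⟩
  · left; omega
  · have := h4 z hz3
    rw [hdeg z hz3] at this
    omega
  · exact Or.inr (Or.inr (Or.inr ⟨by omega, hcub, rfl⟩))
  · have := h8 z hz3
    rw [hdeg z hz3] at this
    omega

/-- The bound follows if a triangle `t₁t₂t₃` with `t₃` deletable has distinct nonadjacent further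
neighbours `s₁`, `s₂` of `t₁`, `t₂`. -/
lemma bounded_of_triangle_of_not_adj {t₁ t₂ t₃ s₁ s₂ s₃ : V} (ih : BoundedBelow V S.card)
    (hcub : ∀ v ∈ S, eb G {v} S = 3) (hS3 : TwoConnOn G (S.erase t₃))
    (ht1 : t₁ ∈ S) (ht2 : t₂ ∈ S) (ht3 : t₃ ∈ S) (hs1 : s₁ ∈ S) (hs2 : s₂ ∈ S) (hs3 : s₃ ∈ S)
    (h12 : G.Adj t₁ t₂) (h13 : G.Adj t₁ t₃) (h23 : G.Adj t₂ t₃)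
    (hts1 : G.Adj t₁ s₁) (hts2 : G.Adj t₂ s₂) (hts3 : G.Adj t₃ s₃)
    (h1 : s₁ ≠ t₂ ∧ s₁ ≠ t₃) (h2 : s₂ ≠ t₁ ∧ s₂ ≠ t₃) (h3 : s₃ ≠ t₁ ∧ s₃ ≠ t₂)
    (hn1 : ∀ w ∈ S, G.Adj t₁ w → w = t₂ ∨ w = t₃ ∨ w = s₁)
    (hn2 : ∀ w ∈ S, G.Adj t₂ w → w = t₁ ∨ w = t₃ ∨ w = s₂)
    (hne : s₁ ≠ s₂) (hnadj : ¬ G.Adj s₁ s₂) : Bounded G σ S := by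
  have hsup1 : Suppressible G (S.erase t₃) t₁ t₂ s₁ := by
    refine ⟨by simp [ht1, h13.ne], by simp [ht2, h23.ne], by simp [hs1, h1.2], h1.1.symm, h12, hts1,
      fun h => ?_, fun w hw hadj => ?_⟩
    · rcases hn2 s₁ hs1 h with rfl | rfl | rfl
      exacts [hts1.ne rfl, h1.2 rfl, hne rfl]
    · obtain ⟨hw3, hwS⟩ := Finset.mem_erase.mp hw
      rcases hn1 w hwS hadj with h | h | h
      exacts [Or.inl h, absurd h hw3, Or.inr h]
  refine bounded_of_erase_of_suppressible (x := t₁) (y := t₂) (p' := s₂) (q' := s₁) (z := s₃) ih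
    hcub ht3 hS3 hsup1 ?_ hs3 hts3 h3.1 h3.2
  refine ⟨by simp [ht2, h12.ne', h23.ne], by simp [hs2, h2.1, h2.2],
    by simp [hs1, h1.2, hts1.ne'], hne.symm, ?_, ?_, ?_, ?_⟩
  · exact Or.inl hts2
  · rw [sup_edge_adj_iff h1.1.symm]
    exact Or.inr (Or.inl ⟨rfl, rfl⟩)
  · rw [sup_edge_adj_iff h1.1.symm]
    rintro (h | ⟨h, -⟩ | ⟨h, -⟩)
    exacts [hnadj h.symm, hts2.ne h.symm, hne h.symm]
  · intro w hw hadj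
    simp only [Finset.mem_erase] at hw
    rw [sup_edge_adj_iff h1.1.symm] at hadj
    rcases hadj with h | ⟨-, h⟩ | ⟨h, -⟩
    · rcases hn2 w hw.2.2 h with h | h | h
      exacts [absurd h hw.1, absurd h hw.2.1, Or.inl h]
    · exact Or.inr h
    · exact absurd h h1.1.symm

/-- If the further neighbours of the vertices of a triangle are pairwise equal or adjacent,
then the graph has at most six vertices. -/
lemma exists_ne_not_adj_of_triangle {t₁ t₂ t₃ s₁ s₂ s₃ : V} (hS : TwoConnOn G S)
    (hcub : ∀ v ∈ S, eb G {v} S = 3) (h7 : 7 ≤ S.card)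
    (ht1 : t₁ ∈ S) (ht2 : t₂ ∈ S) (ht3 : t₃ ∈ S) (hs1 : s₁ ∈ S) (hs2 : s₂ ∈ S) (hs3 : s₃ ∈ S)
    (h12 : G.Adj t₁ t₂) (h13 : G.Adj t₁ t₃) (h23 : G.Adj t₂ t₃)
    (hts1 : G.Adj t₁ s₁) (hts2 : G.Adj t₂ s₂) (hts3 : G.Adj t₃ s₃)
    (hs12 : s₁ ≠ t₂) (hs13 : s₁ ≠ t₃) (hs21 : s₂ ≠ t₁) (hs23 : s₂ ≠ t₃) (hs31 : s₃ ≠ t₁)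
    (hs32 : s₃ ≠ t₂) :
    (s₁ ≠ s₂ ∧ ¬ G.Adj s₁ s₂) ∨ (s₁ ≠ s₃ ∧ ¬ G.Adj s₁ s₃) ∨ (s₂ ≠ s₃ ∧ ¬ G.Adj s₂ s₃) := by
  by_contra hcon
  push Not at hcon
  obtain ⟨c12, c13, c23⟩ := hcon
  let T : Finset V := {t₁, t₂, t₃, s₁, s₂, s₃}
  have hTS : T ⊆ S := by
    intro w hw
    simp only [T, Finset.mem_insert, Finset.mem_singleton] at hw
    rcases hw with rfl | rfl | rfl | rfl | rfl | rfl <;> assumption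
  have hT6 : T.card ≤ 6 := Finset.card_le_six
  have m1 : t₁ ∈ T := by simp [T]
  have m2 : t₂ ∈ T := by simp [T]
  have m3 : t₃ ∈ T := by simp [T]
  have m4 : s₁ ∈ T := by simp [T]
  have m5 : s₂ ∈ T := by simp [T]
  have m6 : s₃ ∈ T := by simp [T]
  have d1 : 3 ≤ eb G {t₁} T :=
    three_le_eb_singleton h23.ne hs12.symm hs13.symm m2 m3 m4 h12 h13 hts1
  have d2 : 3 ≤ eb G {t₂} T :=
    three_le_eb_singleton h13.ne hs21.symm hs23.symm m1 m3 m5 h12.symm h23 hts2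
  have d3 : 3 ≤ eb G {t₃} T :=
    three_le_eb_singleton h12.ne hs31.symm hs32.symm m1 m2 m6 h13.symm h23.symm hts3
  have fin : ∀ s ∈ T, (s₁ = s ∨ 3 ≤ eb G {s₁} T) → (s₂ = s ∨ 3 ≤ eb G {s₂} T) →
      (s₃ = s ∨ 3 ≤ eb G {s₃} T) → 2 ≤ eb G {s} T → False := by
    intro s hs q1 q2 q3 hs2
    have := card_le_of_three_le_eb hS hcub hTS hs (fun v hv hvs => by
      simp only [T, Finset.mem_insert, Finset.mem_singleton] at hv
      rcases hv with rfl | rfl | rfl | rfl | rfl | rfl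
      exacts [d1, d2, d3, q1.resolve_left hvs, q2.resolve_left hvs, q3.resolve_left hvs]) hs2
    omega
  by_cases f12 : s₁ = s₂
  · subst f12
    by_cases f13 : s₁ = s₃
    · subst f13
      exact fin s₁ m4 (Or.inl rfl) (Or.inl rfl) (Or.inl rfl)
        (two_le_eb_singleton h12.ne m1 m2 hts1.symm hts2.symm)
    · have a13 : G.Adj s₁ s₃ := c13 f13
      have := three_le_eb_singleton h12.ne hs31.symm hs32.symm m1 m2 m6 hts1.symm hts2.symm a13
      exact fin s₃ m6 (Or.inr this) (Or.inr this) (Or.inl rfl)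
        (two_le_eb_singleton hs13.symm m3 m4 hts3.symm a13.symm)
  · have a12 : G.Adj s₁ s₂ := c12 f12
    by_cases f13 : s₁ = s₃
    · subst f13
      have := three_le_eb_singleton h13.ne hs21.symm hs23.symm m1 m3 m5 hts1.symm hts3.symm a12
      exact fin s₂ m5 (Or.inr this) (Or.inl rfl) (Or.inr this)
        (two_le_eb_singleton hs12.symm m2 m4 hts2.symm a12.symm)
    · have a13 : G.Adj s₁ s₃ := c13 f13
      by_cases f23 : s₂ = s₃
      · subst f23
        have := three_le_eb_singleton h23.ne hs12.symm hs13.symm m2 m3 m4 hts2.symm hts3.symm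
          a12.symm
        exact fin s₁ m4 (Or.inl rfl) (Or.inr this) (Or.inr this)
          (two_le_eb_singleton hs21.symm m1 m5 hts1.symm a12)
      · have a23 : G.Adj s₂ s₃ := c23 f23
        exact fin s₁ m4 (Or.inl rfl)
          (Or.inr (three_le_eb_singleton hs12.symm hs32.symm f13 m2 m4 m6 hts2.symm a12.symm a23))
          (Or.inr (three_le_eb_singleton hs13.symm hs23.symm f12 m3 m4 m5 hts3.symm a13.symm
            a23.symm))
          (two_le_eb_singleton hs21.symm m1 m5 hts1.symm a12)

/-- The inductive step for cubic graphs with a triangle in an end. -/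
lemma IsEnd.bounded_of_triangle {t₁ t₂ t₃ : V} (h : IsEnd G S X) (ih : BoundedBelow V S.card)
    (hS : TwoConnOn G S) (hcub : ∀ v ∈ S, eb G {v} S = 3) (h7 : 7 ≤ S.card) (ht1 : t₁ ∈ X)
    (ht2 : t₂ ∈ S) (ht3 : t₃ ∈ S) (h12 : G.Adj t₁ t₂) (h13 : G.Adj t₁ t₃) (h23 : G.Adj t₂ t₃) :
    Bounded G σ S := by
  have ht1S := h.sub ht1
  have hmem : ∀ {a b : V}, a ∈ S → b ∈ S → G.Adj t₁ a → G.Adj t₁ b → G.Adj a b → a ∈ X := by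
    intro a b ha hb h1a h1b hab
    by_contra haX
    have haX' : a ∈ S \ X := Finset.mem_sdiff.mpr ⟨ha, haX⟩
    by_cases hbX : b ∈ X
    · exact h1b.ne (eq_of_eb_singleton_le_one (h.eb_in_le hcub hS haX') ht1 hbX h1a.symm hab)
    · exact hab.ne (eq_of_eb_singleton_le_one (h.eb_out_le hcub ht1) haX'
        (Finset.mem_sdiff.mpr ⟨hb, hbX⟩) h1a h1b)
  have ht2X : t₂ ∈ X := hmem ht2 ht3 h12 h13 h23
  have ht3X : t₃ ∈ X := hmem ht3 ht2 h13 h12 h23.symm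
  obtain ⟨s₁, hs12, hs13, hs1, hts1, hn1⟩ :=
    exists_third (hcub t₁ ht1S) h23.ne ht2 ht3 h12 h13
  obtain ⟨s₂, hs21, hs23, hs2, hts2, hn2⟩ :=
    exists_third (hcub t₂ ht2) h13.ne ht1S ht3 h12.symm h23
  obtain ⟨s₃, hs31, hs32, hs3, hts3, hn3⟩ :=
    exists_third (hcub t₃ ht3) h12.ne ht1S ht2 h13.symm h23.symm
  have hin : ∀ {a s : V}, eb G {a} (S \ X) = 0 → s ∈ S → G.Adj a s → s ∈ X := by
    intro a s ha hs has
    by_contra hsX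
    exact (eb_eq_zero_iff G _ _).mp ha a (Finset.mem_singleton_self a) s
      (Finset.mem_sdiff.mpr ⟨hs, hsX⟩) has
  have hout : ∀ {a s s' : V}, a ∈ X → s ∈ S → s ∉ X → G.Adj a s → s' ∈ X → s' ≠ a →
      s ≠ s' ∧ ¬ G.Adj s s' := by
    intro a s s' ha hs hsX has hs'X hne
    refine ⟨fun e => hsX (e ▸ hs'X), fun hadj => hne ?_⟩
    exact eq_of_eb_singleton_le_one (h.eb_in_le hcub hS (Finset.mem_sdiff.mpr ⟨hs, hsX⟩)) hs'X ha
      hadj has.symm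
  have hdel : ∀ {a : V}, a ∈ X → eb G {a} (S \ X) = 0 → TwoConnOn G (S.erase a) :=
    fun ha h0 => h.twoConnOn_erase hcub hS ha h0
  have z12 := h.eb_out_eq_zero_of_adj hcub ht1 ht2X h12
  have z13 := h.eb_out_eq_zero_of_adj hcub ht1 ht3X h13
  have z23 := h.eb_out_eq_zero_of_adj hcub ht2X ht3X h23
  have use3 : eb G {t₃} (S \ X) = 0 → s₁ ≠ s₂ ∧ ¬ G.Adj s₁ s₂ → Bounded G σ S := fun h0 hs =>
    bounded_of_triangle_of_not_adj ih hcub (hdel ht3X h0) ht1S ht2 ht3 hs1 hs2 hs3 h12 h13 h23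
      hts1 hts2 hts3 ⟨hs12, hs13⟩ ⟨hs21, hs23⟩ ⟨hs31, hs32⟩ hn1 hn2 hs.1 hs.2
  have use2 : eb G {t₂} (S \ X) = 0 → s₁ ≠ s₃ ∧ ¬ G.Adj s₁ s₃ → Bounded G σ S := fun h0 hs =>
    bounded_of_triangle_of_not_adj ih hcub (hdel ht2X h0) ht1S ht3 ht2 hs1 hs3 hs2 h13 h12
      h23.symm hts1 hts3 hts2 ⟨hs13, hs12⟩ ⟨hs31, hs32⟩ ⟨hs21, hs23⟩
      (fun w hw hadj => or_left_comm.mp (hn1 w hw hadj)) hn3 hs.1 hs.2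
  have use1 : eb G {t₁} (S \ X) = 0 → s₂ ≠ s₃ ∧ ¬ G.Adj s₂ s₃ → Bounded G σ S := fun h0 hs =>
    bounded_of_triangle_of_not_adj ih hcub (hdel ht1 h0) ht2 ht3 ht1S hs2 hs3 hs1 h23
      h12.symm h13.symm hts2 hts3 hts1 ⟨hs23, hs21⟩ ⟨hs32, hs31⟩ ⟨hs12, hs13⟩
      (fun w hw hadj => or_left_comm.mp (hn2 w hw hadj))
      (fun w hw hadj => or_left_comm.mp (hn3 w hw hadj)) hs.1 hs.2
  by_cases i1 : s₁ ∈ X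
  swap
  · have hpos := eb_pos_of_adj (Finset.mem_singleton_self t₁)
      (Finset.mem_sdiff.mpr ⟨hs1, i1⟩) hts1
    exact use3 (z13 hpos) (hout ht1 hs1 i1 hts1 (hin (z12 hpos) hs2 hts2) hs21)
  by_cases i2 : s₂ ∈ X
  swap
  · have hpos := eb_pos_of_adj (Finset.mem_singleton_self t₂)
      (Finset.mem_sdiff.mpr ⟨hs2, i2⟩) hts2
    obtain ⟨e1, e2⟩ := hout ht2X hs2 i2 hts2 i1 hs12
    exact use3 (z23 hpos) ⟨e1.symm, fun h' => e2 h'.symm⟩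
  by_cases i3 : s₃ ∈ X
  swap
  · have hpos := eb_pos_of_adj (Finset.mem_singleton_self t₃)
      (Finset.mem_sdiff.mpr ⟨hs3, i3⟩) hts3
    obtain ⟨e1, e2⟩ := hout ht3X hs3 i3 hts3 i1 hs13
    exact use2 (h.eb_out_eq_zero_of_adj hcub ht3X ht2X h23.symm hpos)
      ⟨e1.symm, fun h' => e2 h'.symm⟩
  have hz : ∀ {a : V}, (∀ w ∈ S, G.Adj a w → w ∈ X) → eb G {a} (S \ X) = 0 := by
    intro a ha
    rw [eb_eq_zero_iff]
    intro a' ha' w hw hadj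
    rw [Finset.mem_singleton.mp ha'] at hadj
    exact (Finset.mem_sdiff.mp hw).2 (ha w (Finset.mem_sdiff.mp hw).1 hadj)
  rcases exists_ne_not_adj_of_triangle hS hcub h7 ht1S ht2 ht3 hs1 hs2 hs3 h12 h13 h23 hts1 hts2
    hts3 hs12 hs13 hs21 hs23 hs31 hs32 with e | e | e
  · exact use3 (hz fun w hw hadj => by rcases hn3 w hw hadj with rfl | rfl | rfl <;> assumption) e
  · exact use2 (hz fun w hw hadj => by rcases hn2 w hw hadj with rfl | rfl | rfl <;> assumption) e
  · exact use1 (hz fun w hw hadj => by rcases hn1 w hw hadj with rfl | rfl | rfl <;> assumption) e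

/-- The bound follows by deletion of a vertex `v` and suppression of two of its neighbours,
in the absence of triangles. -/
lemma bounded_of_erase_of_ne {v x y z p q p' q' : V} (ih : BoundedBelow V S.card)
    (hcub : ∀ v ∈ S, eb G {v} S = 3) (hv : v ∈ S) (hSv : TwoConnOn G (S.erase v))
    (hx : Suppressible G (S.erase v) x p q) (hy : Suppressible G (S.erase v) y p' q')
    (hxy : x ≠ y) (hnxy : ¬ G.Adj x y)
    (hz : z ∈ S) (hvz : G.Adj v z) (hzx : z ≠ x) (hzy : z ≠ y) (hne : s(p, q) ≠ s(p', q')) :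
    Bounded G σ S := by
  have hyp : y ≠ p := fun e => hnxy (e ▸ hx.adj_left)
  have hyq : y ≠ q := fun e => hnxy (e ▸ hx.adj_right)
  have hp' : p' ≠ x := fun e => hnxy (e ▸ hy.adj_left.symm)
  have hq' : q' ≠ x := fun e => hnxy (e ▸ hy.adj_right.symm)
  refine bounded_of_erase_of_suppressible ih hcub hv hSv hx
    (⟨Finset.mem_erase.mpr ⟨hxy.symm, hy.mem⟩, Finset.mem_erase.mpr ⟨hp', hy.mem_left⟩,
      Finset.mem_erase.mpr ⟨hq', hy.mem_right⟩, hy.ne, Or.inl hy.adj_left, Or.inl hy.adj_right,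
      ?_, ?_⟩ : Suppressible _ _ y p' q') hz hvz hzx hzy
  · rw [sup_edge_adj_iff hx.ne]
    rintro (h | ⟨rfl, rfl⟩ | ⟨rfl, rfl⟩)
    exacts [hy.not_adj h, hne rfl, hne Sym2.eq_swap]
  · intro w hw hadj
    rw [sup_edge_adj_iff hx.ne] at hadj
    rcases hadj with h | ⟨h, -⟩ | ⟨h, -⟩
    exacts [hy.eq_or w (Finset.mem_of_mem_erase hw) h, absurd h hyp, absurd h hyq]

/-- The inductive step for cubic graphs with an end meeting no triangle. -/
lemma IsEnd.bounded_of_no_triangle (h : IsEnd G S X) (ih : BoundedBelow V S.card)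
    (hS : TwoConnOn G S) (hcub : ∀ v ∈ S, eb G {v} S = 3) (h7 : 7 ≤ S.card)
    (hno : ∀ a ∈ X, ∀ b ∈ S, ∀ c ∈ S, G.Adj a b → G.Adj a c → ¬ G.Adj b c) : Bounded G σ S := by
  obtain ⟨v, hvX, hv0⟩ := h.exists_interior hcub
  have hv := h.sub hvX
  have hSv := h.twoConnOn_erase hcub hS hvX hv0
  obtain ⟨x, y, z, hxy, hxz, hyz, hx, hy, hz, hvx, hvy, hvz, -⟩ :=
    exists_triple_of_eb_eq_three (hcub v hv)
  have hin : ∀ w ∈ S, G.Adj v w → w ∈ X := by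
    intro w hw hadj
    by_contra hwX
    exact (eb_eq_zero_iff G _ _).mp hv0 v (Finset.mem_singleton_self v) w
      (Finset.mem_sdiff.mpr ⟨hw, hwX⟩) hadj
  have hsup : ∀ w ∈ S, G.Adj v w → ∃ p q, Suppressible G (S.erase v) w p q := by
    intro w hw hvw
    obtain ⟨p, q, hpq, hpv, hqv, hp, hq, hwp, hwq, hn⟩ :=
      exists_other_two (hcub w hw) hv hvw.symm
    refine ⟨p, q, Finset.mem_erase.mpr ⟨hvw.ne', hw⟩, Finset.mem_erase.mpr ⟨hpv, hp⟩,
      Finset.mem_erase.mpr ⟨hqv, hq⟩, hpq, hwp, hwq, hno w (hin w hw hvw) p hp q hq hwp hwq,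
      fun u hu hwu => ?_⟩
    obtain ⟨huv, huS⟩ := Finset.mem_erase.mp hu
    exact (hn u huS hwu).resolve_left huv
  obtain ⟨p, q, hxs⟩ := hsup x hx hvx
  obtain ⟨p', q', hys⟩ := hsup y hy hvy
  obtain ⟨p'', q'', hzs⟩ := hsup z hz hvz
  by_cases e1 : s(p, q) = s(p', q')
  swap
  · exact bounded_of_erase_of_ne ih hcub hv hSv hxs hys hxy
      (hno v hvX x hx y hy hvx hvy) hz hvz hxz.symm hyz.symm e1
  by_cases e2 : s(p, q) = s(p'', q'')
  swap
  · exact bounded_of_erase_of_ne ih hcub hv hSv hxs hzs hxz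
      (hno v hvX x hx z hz hvx hvz) hy hvy hxy.symm hyz e2
  exfalso
  have hyadj : G.Adj y p ∧ G.Adj y q := by
    rcases Sym2.eq_iff.mp e1 with ⟨rfl, rfl⟩ | ⟨rfl, rfl⟩
    exacts [⟨hys.adj_left, hys.adj_right⟩, ⟨hys.adj_right, hys.adj_left⟩]
  have hzadj : G.Adj z p ∧ G.Adj z q := by
    rcases Sym2.eq_iff.mp e2 with ⟨rfl, rfl⟩ | ⟨rfl, rfl⟩
    exacts [⟨hzs.adj_left, hzs.adj_right⟩, ⟨hzs.adj_right, hzs.adj_left⟩]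
  obtain ⟨hpv, hp⟩ := Finset.mem_erase.mp hxs.mem_left
  obtain ⟨hqv, hq⟩ := Finset.mem_erase.mp hxs.mem_right
  let T : Finset V := {v, x, y, z, p, q}
  have hTS : T ⊆ S := by
    intro w hw
    simp only [T, Finset.mem_insert, Finset.mem_singleton] at hw
    rcases hw with rfl | rfl | rfl | rfl | rfl | rfl <;> assumption
  have hT6 : T.card ≤ 6 := Finset.card_le_six
  have m1 : v ∈ T := by simp [T]
  have m2 : x ∈ T := by simp [T]
  have m3 : y ∈ T := by simp [T]
  have m4 : z ∈ T := by simp [T]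
  have m5 : p ∈ T := by simp [T]
  have m6 : q ∈ T := by simp [T]
  have hd : ∀ w ∈ T, 3 ≤ eb G {w} T := by
    intro w hw
    simp only [T, Finset.mem_insert, Finset.mem_singleton] at hw
    rcases hw with rfl | rfl | rfl | rfl | rfl | rfl
    · exact three_le_eb_singleton hxy hxz hyz m2 m3 m4 hvx hvy hvz
    · exact three_le_eb_singleton hpv.symm hqv.symm hxs.ne m1 m5 m6 hvx.symm hxs.adj_left
        hxs.adj_right
    · exact three_le_eb_singleton hpv.symm hqv.symm hxs.ne m1 m5 m6 hvy.symm hyadj.1 hyadj.2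
    · exact three_le_eb_singleton hpv.symm hqv.symm hxs.ne m1 m5 m6 hvz.symm hzadj.1 hzadj.2
    · exact three_le_eb_singleton hxy hxz hyz m2 m3 m4 hxs.adj_left.symm hyadj.1.symm hzadj.1.symm
    · exact three_le_eb_singleton hxy hxz hyz m2 m3 m4 hxs.adj_right.symm hyadj.2.symm
        hzadj.2.symm
  have := card_le_of_three_le_eb hS hcub hTS m1 (fun w hw _ => hd w hw)
    ((by omega : 2 ≤ 3).trans (hd v m1))
  omega

lemma eb_singleton_lt_card {v : V} (hv : v ∈ S) : eb G {v} S < S.card := by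
  rw [eb_singleton]
  exact Finset.card_lt_card (Finset.filter_ssubset.mpr ⟨v, hv, G.loopless.irrefl v⟩)

/-- Graphs on four vertices have frustration index at most two. -/
lemma frustLE_two_of_card_eq_four (h4 : S.card = 4) : FrustLE G σ S 2 := by
  have step : ∀ (T : Finset V) (n k m : ℕ), T.card = n + 1 → n ≤ 2 * m + 1 →
      (∀ T' : Finset V, T'.card = n → FrustLE G σ T' k) → FrustLE G σ T (k + m) := by
    intro T n k m hT hm h
    obtain ⟨v, hv⟩ : T.Nonempty := Finset.card_pos.mp (by omega)
    have := Finset.card_erase_add_one hv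
    have h1 := eb_singleton_lt_card (G := G) hv
    exact (h (T.erase v) (by omega)).insert hv (by omega)
  exact step S 3 1 1 h4 (by omega) fun T hT => step T 2 0 1 hT (by omega) fun T hT =>
    step T 1 0 0 hT (by omega) fun T hT => step T 0 0 0 hT (by omega) fun T hT => by
      rw [Finset.card_eq_zero.mp hT]; exact frustLE_empty

/-- The inductive step for cubic graphs. -/
theorem bounded_of_cubic (ih : BoundedBelow V S.card) (hS : TwoConnOn G S) (hn : S.Nonempty)
    (hcub : ∀ v ∈ S, eb G {v} S = 3) : Bounded G σ S := by
  obtain ⟨X, h⟩ := exists_isEnd (G := G) hn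
  by_cases h7 : 7 ≤ S.card
  · by_cases ht : ∃ a ∈ X, ∃ b ∈ S, ∃ c ∈ S, G.Adj a b ∧ G.Adj a c ∧ G.Adj b c
    · obtain ⟨a, ha, b, hb, c, hc, hab, hac, hbc⟩ := ht
      exact h.bounded_of_triangle ih hS hcub h7 ha hb hc hab hac hbc
    · exact h.bounded_of_no_triangle ih hS hcub h7 fun a ha b hb c hc hab hac hbc =>
        ht ⟨a, ha, b, hb, c, hc, hab, hac, hbc⟩
  obtain ⟨v, hvX, hv0⟩ := h.exists_interior hcub
  have hv := h.sub hvX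
  have hc4 := eb_singleton_lt_card (G := G) hv
  rw [hcub v hv] at hc4
  by_cases h4 : S.card = 4
  · exact ⟨2, frustLE_two_of_card_eq_four h4, Or.inr (Or.inl ⟨h4, hcub, rfl⟩)⟩
  have hcard := Finset.card_erase_add_one hv
  obtain ⟨x, y, -, hxy, -, -, hx, hy, -, hvx, hvy, -, -⟩ :=
    exists_triple_of_eb_eq_three (hcub v hv)
  have hlow : ∀ w ∈ S, G.Adj v w → eb G {w} (S.erase v) ≤ 2 := by
    intro w hw hvw
    have h1 := hcub w hw
    rw [← eb_erase_add hv] at h1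
    have := eb_pos_of_adj (Finset.mem_singleton_self w) (Finset.mem_singleton_self v) hvw.symm
    omega
  obtain ⟨k, hk, hk3⟩ := (ih G σ (S.erase v) (by omega) (h.twoConnOn_erase hcub hS hvX hv0)
    (fun u hu => (eb_mono_right G _ (Finset.erase_subset _ _)).trans
      (hcub u (Finset.mem_of_mem_erase hu)).le)).of_two_low
    (Finset.mem_erase.mpr ⟨hvx.ne', hx⟩) (Finset.mem_erase.mpr ⟨hvy.ne', hy⟩) hxy
    (hlow x hx hvx) (hlow y hy hvy)
  have h2 : FrustLE G σ S 2 := (hk.insert hv (m := 1) (hcub v hv).le).mono (by omega)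
  by_cases h5 : S.card = 5
  · refine ⟨2, h2, Or.inr (Or.inr (Or.inl ⟨h5, fun u hu _ _ hu2 => ?_, rfl⟩))⟩
    have := hcub u hu
    omega
  · exact ⟨2, h2, Or.inl (by omega)⟩

/-- Every 2-edge-connected subcubic signed graph that is not of exceptional shape has frustration
index at most a third of its order. -/
theorem bounded_of_twoConnOn (hS : TwoConnOn G S) (hdeg : ∀ v ∈ S, eb G {v} S ≤ 3) :
    Bounded G σ S := by
  induction hm : S.card using Nat.strong_induction_on generalizing G σ S with
  | _ m ihm =>
  have ih : BoundedBelow V S.card := fun G' σ' S' hlt h2 h3 => ihm _ (hm ▸ hlt) h2 h3 rfl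
  rcases S.eq_empty_or_nonempty with rfl | hn
  · exact ⟨0, frustLE_empty, Or.inl (by omega)⟩
  by_cases hx : ∃ x ∈ S, eb G {x} S ≤ 2
  · obtain ⟨x, hx, hx2⟩ := hx
    exact bounded_of_deg_le_two ih hS hdeg hx hx2
  · push Not at hx
    exact bounded_of_cubic ih hS hn fun v hv => le_antisymm (hdeg v hv) (hx v hv)

end

section Search

/-- Whether all entries of `l` satisfy `p`; a single recursor application, so that the kernel
evaluates it quickly. -/
noncomputable def allRec {α : Type*} (l : List α) (p : α → Bool) : Bool :=
  List.rec true (fun a _ ih => bif p a then ih else false) l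

/-- Backtracking over the choices of one entry from each list in `cs` that are pairwise related
by `ok`: does every such choice, prepended in reverse to `l`, satisfy `leaf`? -/
noncomputable def search {α : Type*} (ok : α → α → Bool) (leaf : List α → Bool)
    (cs : List (List α)) : List α → Bool :=
  List.rec leaf
    (fun c _ ih l => allRec c fun x => bif allRec l fun y => ok y x then ih (x :: l) else true) cs

/-- A numbered row of an adjacency matrix, as a bit mask. -/
structure Row where
  idx : ℕ
  mask : ℕ

/-- A vertex of a signed graph with bit masks of its neighbours and of its negative edges. -/
structure Target where
  idx : ℕ
  adj : ℕ
  neg : ℕ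

/-- Whether `{i, j}` is one of the first `k` pairs `{0, 1}, {2, 3}, …`. -/
def partner (k i j : ℕ) : Bool := i ^^^ 1 == j && i.blt (2 * k)

/-- Compatibility of two assignments of target vertices to rows whose negative edges are the
first `k` pairs. -/
def isoOK (k : ℕ) (y x : Row × Target) : Bool :=
  bif y.2.idx.beq x.2.idx then false else
  bif y.1.mask.testBit x.1.idx == y.2.adj.testBit x.2.idx then
    !(y.1.mask.testBit x.1.idx) || partner k y.1.idx x.1.idx == y.2.neg.testBit x.2.idx
  else false

/-- Whether the signed graph with the given rows is isomorphic to the target. -/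
noncomputable def isoTo (k : ℕ) (T : List Target) (l : List Row) : Bool :=
  !(search (isoOK k) (fun _ => false) (l.reverse.map fun x => T.map fun t => (x, t)) [])

/-- The number of the first `n` bits of `m` that are set. -/
def bits (n m : ℕ) : ℕ := ((List.range n).filter m.testBit).length

/-- Constraints on the row `m` with index `i`. -/
def rowOK (n k lo i m : ℕ) : Bool :=
  ((bits n m == 3 || bits n m == lo) && !(m.testBit i)) &&
    (!(i.blt (2 * k)) || (m.testBit (i ^^^ 1) &&
      (List.range (2 * k)).all fun j => !(m.testBit j) || j / 2 == i / 2 ||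
        (bits n m == 3 && (List.range (2 * k)).all fun l =>
          !(m.testBit l) || l / 2 == i / 2 || j / 2 == l / 2)))

/-- The rows with index `i` satisfying `rowOK`. -/
def rows (n k lo i : ℕ) : List Row := ((List.range (2 ^ n)).filter (rowOK n k lo i)).map (Row.mk i)

/-- Constraints on two rows. -/
def pairOK (n k lo : ℕ) (y x : Row) : Bool :=
  bif y.mask.testBit x.idx == x.mask.testBit y.idx then
    (!(y.idx.blt (2 * k) && !(x.idx.blt (2 * k)) && y.mask.testBit x.idx) ||
      (List.range (2 * k)).all fun b =>
        b / 2 == y.idx / 2 || !(y.mask.testBit b && x.mask.testBit b)) &&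
    (!(partner k y.idx x.idx) || (List.range k).all fun b =>
      !(y.mask.testBit (2 * b) && y.mask.testBit (2 * b + 1) &&
        x.mask.testBit (2 * b) && x.mask.testBit (2 * b + 1))) &&
    (lo == 3 || bits n y.mask == 3 || bits n x.mask == 3)
  else false

/-- `Γ₁`. -/
def targets1 : List Target := [⟨0, 14, 2⟩, ⟨1, 13, 1⟩, ⟨2, 11, 8⟩, ⟨3, 7, 4⟩]

/-- `Γ₂`. -/
def targets2 : List Target := [⟨0, 14, 8⟩, ⟨1, 25, 16⟩, ⟨2, 25, 0⟩, ⟨3, 7, 1⟩, ⟨4, 6, 2⟩]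

/-- `Γ₂`, switched. -/
def targets2' : List Target := [⟨0, 14, 2⟩, ⟨1, 25, 1⟩, ⟨2, 25, 8⟩, ⟨3, 7, 4⟩, ⟨4, 6, 0⟩]

/-- `Γ₃`. -/
def targets3 : List Target :=
  [⟨0, 70, 2⟩, ⟨1, 69, 1⟩, ⟨2, 11, 0⟩, ⟨3, 148, 0⟩, ⟨4, 168, 128⟩, ⟨5, 208, 64⟩, ⟨6, 35, 32⟩,
    ⟨7, 56, 16⟩]

/-- `Γ₃`, switched. -/
def targets3' : List Target :=
  [⟨0, 70, 2⟩, ⟨1, 69, 1⟩, ⟨2, 11, 0⟩, ⟨3, 148, 16⟩, ⟨4, 168, 8⟩, ⟨5, 208, 128⟩, ⟨6, 35, 0⟩,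
    ⟨7, 56, 32⟩]

/-- `Γ₄`. -/
def targets4 : List Target :=
  [⟨0, 134, 4⟩, ⟨1, 37, 0⟩, ⟨2, 11, 1⟩, ⟨3, 84, 16⟩, ⟨4, 104, 8⟩, ⟨5, 146, 128⟩, ⟨6, 152, 0⟩,
    ⟨7, 97, 32⟩]

/-- `Γ₄`, switched. -/
def targets4' : List Target :=
  [⟨0, 134, 2⟩, ⟨1, 37, 1⟩, ⟨2, 11, 0⟩, ⟨3, 84, 64⟩, ⟨4, 104, 32⟩, ⟨5, 146, 16⟩, ⟨6, 152, 8⟩,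
    ⟨7, 97, 0⟩]

/-- `Γ₄`, switched in a third way. -/
def targets4'' : List Target :=
  [⟨0, 134, 2⟩, ⟨1, 37, 1⟩, ⟨2, 11, 8⟩, ⟨3, 84, 4⟩, ⟨4, 104, 64⟩, ⟨5, 146, 0⟩, ⟨6, 152, 16⟩,
    ⟨7, 97, 0⟩]

/-- `Γ₅`. -/
def targets5 : List Target :=
  [⟨0, 26, 8⟩, ⟨1, 37, 32⟩, ⟨2, 74, 0⟩, ⟨3, 133, 1⟩, ⟨4, 161, 0⟩, ⟨5, 82, 2⟩, ⟨6, 164, 128⟩,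
    ⟨7, 88, 64⟩]

lemma isoTo_four : isoTo 2 targets1 [⟨3, 7⟩, ⟨2, 11⟩, ⟨1, 13⟩, ⟨0, 14⟩] = true := by
  decide +kernel

lemma search_five : search (pairOK 5 2 2) (fun l => isoTo 2 targets2 l || isoTo 2 targets2' l)
    ((List.range 5).map (rows 5 2 2)) [] = true := by
  decide +kernel

lemma search_eight : search (pairOK 8 3 3) (fun l => isoTo 3 targets4' l || isoTo 3 targets4 l ||
      isoTo 3 targets4'' l || isoTo 3 targets3' l || isoTo 3 targets5 l || isoTo 3 targets3 l)
    ((List.range 8).map (rows 8 3 3)) [] = true := by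
  decide +kernel

end Search

section SearchCorrect

variable {α : Type*} {ok : α → α → Bool} {leaf : List α → Bool}

lemma allRec_eq_all (l : List α) (p : α → Bool) : allRec l p = l.all p := by
  induction l with
  | nil => rfl
  | cons a l ih =>
    change (bif p a then allRec l p else false) = _
    rw [ih, List.all_cons]
    cases p a <;> rfl

lemma search_cons (c : List α) (cs : List (List α)) (l : List α) :
    search ok leaf (c :: cs) l = true ↔
      ∀ x ∈ c, (∀ y ∈ l, ok y x = true) → search ok leaf cs (x :: l) = true := by
  change (allRec c fun x => bif allRec l fun y => ok y x then
    search ok leaf cs (x :: l) else true) = true ↔ _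
  simp only [allRec_eq_all, List.all_eq_true]
  refine forall₂_congr fun x _ => ?_
  rw [← List.all_eq_true]
  cases l.all fun y => ok y x <;> simp

lemma search_iff (cs : List (List α)) (l : List α) (hl : l.Pairwise fun x y => ok y x = true) :
    search ok leaf cs l = true ↔ ∀ t, List.Forall₂ (· ∈ ·) t cs →
      ((t.reverse ++ l).Pairwise fun x y => ok y x = true) → leaf (t.reverse ++ l) = true := by
  induction cs generalizing l with
  | nil =>
    constructor
    · rintro h t ht -
      rw [List.forall₂_nil_right_iff.mp ht]
      exact h
    · intro h
      exact h [] .nil hl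
  | cons c cs ih =>
    rw [search_cons]
    constructor
    · intro h t ht hp
      obtain ⟨x, t, hx, ht', rfl⟩ := List.forall₂_cons_right_iff.mp ht
      rw [List.reverse_cons, List.append_assoc, List.singleton_append] at hp ⊢
      have hp' := (List.pairwise_append.mp hp).2.1
      exact (ih (x :: l) hp').mp (h x hx (List.pairwise_cons.mp hp').1) t ht' hp
    · intro h x hx hxl
      refine (ih (x :: l) (List.pairwise_cons.mpr ⟨hxl, hl⟩)).mpr fun t ht hp => ?_
      have := h (x :: t) (.cons hx ht)
      rw [List.reverse_cons, List.append_assoc, List.singleton_append] at this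
      exact this hp

lemma search_ofFn {n : ℕ} (C : Fin n → List α) :
    search ok leaf (List.ofFn C) [] = true ↔ ∀ r : Fin n → α, (∀ i, r i ∈ C i) →
      (∀ i j, i < j → ok (r i) (r j) = true) → leaf (List.ofFn r).reverse = true := by
  rw [search_iff _ _ .nil]
  constructor
  · intro h r hr hok
    have := h (List.ofFn r) (List.forall₂_iff_get.mpr ⟨by simp, fun i h1 h2 => by simpa using hr _⟩)
    rw [List.append_nil, List.pairwise_reverse, List.pairwise_ofFn] at this
    exact this hok
  · intro h t ht hp
    obtain ⟨hlen, hmem⟩ := List.forall₂_iff_get.mp ht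
    rw [List.length_ofFn] at hlen
    subst hlen
    rw [List.append_nil, List.pairwise_reverse] at hp
    have := h t.get (fun i => by simpa using hmem i i.2 (by simp))
      fun i j hij => List.pairwise_iff_get.mp hp i j hij
    rwa [List.ofFn_get, ← List.append_nil t.reverse] at this

/-- `T` lists the vertices of the signed graph `(H, τ)`, with negative edges recorded after
switching at the set encoded by `x`. -/
def Describes {n : ℕ} (T : List Target) (x : ℕ) (H : SimpleGraph (Fin n))
    (τ : Sym2 (Fin n) → Bool) : Prop :=
  ∀ t ∈ T, ∃ p : Fin n, t.idx = p ∧ ∀ q : Fin n, (t.adj.testBit q = true ↔ H.Adj p q) ∧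
    (H.Adj p q → (t.neg.testBit q = true ↔ (τ s(p, q) = true ↔ x.testBit p = x.testBit q)))

/-- The adjacency matrix of `G` with respect to the enumeration `f` of its vertices. -/
def IsMatrix {V : Type*} {n : ℕ} (G : SimpleGraph V) (f : Fin n ≃ V) (m : Fin n → ℕ) : Prop :=
  ∀ i j : Fin n, (m i).testBit j = true ↔ G.Adj (f i) (f j)

/-- The edges of `G` whose signs are not explained by the colouring `c` are the pairs
`{f 0, f 1}, {f 2, f 3}, …` up to `k`. -/
def IsNegMatching {V : Type*} {n : ℕ} (G : SimpleGraph V) (σ : Sym2 V → Bool) (c : V → Bool)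
    (k : ℕ) (f : Fin n ≃ V) : Prop :=
  ∀ i j : Fin n, partner k i j = true ↔
    G.Adj (f i) (f j) ∧ σ s(f i, f j) ≠ xor (c (f i)) (c (f j))

lemma siso_of_isoTo {V : Type*} {n k x : ℕ} {G : SimpleGraph V} {σ : Sym2 V → Bool}
    {c : V → Bool} {f : Fin n ≃ V} {m : Fin n → ℕ} (hm : IsMatrix G f m)
    (hN : IsNegMatching G σ c k f) {H : SimpleGraph (Fin n)} {τ : Sym2 (Fin n) → Bool}
    {T : List Target} (hT : Describes T x H τ)
    (h : isoTo k T (List.ofFn fun i : Fin n => Row.mk i (m i)).reverse = true) :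
    SIso G σ H τ := by
  rw [isoTo, List.reverse_reverse, List.map_ofFn, Bool.not_eq_true', ← Bool.not_eq_true,
    search_ofFn] at h
  push Not at h
  obtain ⟨r, hr, hok, -⟩ := h
  simp only [Function.comp_apply, List.mem_map] at hr
  choose t htT htr using hr
  choose π hπ hadj hneg using fun i => hT (t i) (htT i)
  have hlt : ∀ i j : Fin n, i < j → π i ≠ π j ∧ (G.Adj (f i) (f j) ↔ H.Adj (π i) (π j)) ∧
      (G.Adj (f i) (f j) → (partner k i j = true ↔
        (τ s(π i, π j) = true ↔ x.testBit (π i) = x.testBit (π j)))) := by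
    intro i j hij
    have := hok i j hij
    simp only [← htr, isoOK, hπ] at this
    have hA := hadj i (π j)
    have hB := hm i j
    have hC := hneg i (π j)
    rw [Ne, Fin.ext_iff, ← hA, ← hB]
    rw [← hA] at hC
    by_cases h0 : (π i : ℕ) = π j
    · simp [h0] at this
    refine ⟨h0, ?_⟩
    rw [← Nat.beq_eq, Bool.not_eq_true] at h0
    rw [h0] at this
    cases h1 : (m i).testBit j <;> cases h2 : (t i).adj.testBit (π j) <;>
      cases h3 : (t i).neg.testBit (π j) <;> simp_all
  have hne : ∀ i j : Fin n, i ≠ j → π i ≠ π j ∧ (G.Adj (f i) (f j) ↔ H.Adj (π i) (π j)) ∧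
      (G.Adj (f i) (f j) → (partner k i j = true ↔
        (τ s(π i, π j) = true ↔ x.testBit (π i) = x.testBit (π j)))) := by
    intro i j hij
    rcases lt_or_gt_of_ne hij with hij | hij
    · exact hlt i j hij
    · obtain ⟨h1, h2, h3⟩ := hlt j i hij
      rw [hN] at h3 ⊢
      rw [G.adj_comm, H.adj_comm, Sym2.eq_swap, Bool.xor_comm, Sym2.eq_swap (a := π i),
        eq_comm (a := x.testBit (π i))]
      exact ⟨h1.symm, h2, h3⟩
  have hinj : Function.Injective π := fun i j h => by
    by_contra hij
    exact (hne i j hij).1 h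
  let e : Fin n ≃ Fin n := Equiv.ofBijective π (Finite.injective_iff_bijective.mp hinj)
  refine ⟨⟨f.symm.trans e, fun {a b} => ?_⟩,
    {v | xor (c v) (x.testBit (π (f.symm v))) = true}, fun s => ?_⟩
  · obtain ⟨i, rfl⟩ := f.surjective a
    obtain ⟨j, rfl⟩ := f.surjective b
    by_cases hij : i = j
    · simp [hij]
    · simpa [e] using (hne i j hij).2.1.symm
  · induction s with
    | _ a b =>
    intro hab
    obtain ⟨i, rfl⟩ := f.surjective a
    obtain ⟨j, rfl⟩ := f.surjective b
    rw [SimpleGraph.mem_edgeSet] at hab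
    have h3 := (hne i j fun h => hab.ne (congrArg f h)).2.2 hab
    rw [hN] at h3
    simp only [hab, true_and] at h3
    simp only [sgnSwitch, sgnCross, Sym2.lift_mk, Sym2.map_mk, Set.mem_ofPred_eq,
      Equiv.symm_apply_apply, Bool.decide_eq_true, RelIso.coe_fn_mk, Equiv.trans_apply,
      Equiv.ofBijective_apply, e]
    revert h3
    generalize σ s(f i, f j) = u, c (f i) = p, c (f j) = q, x.testBit (π i) = v,
      x.testBit (π j) = w, τ s(π i, π j) = y
    revert u p q v w y
    decide

set_option synthInstance.maxHeartbeats 400000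
set_option synthInstance.maxSize 2000

lemma describes1 : Describes targets1 0 gamma1G gamma1S := by
  simp only [Describes, gamma1G, gamma1S, SimpleGraph.top_adj, decide_eq_true_iff]
  decide +kernel

lemma describes2 : Describes targets2 0 gamma2G gamma2S := by
  simp only [Describes, gamma2G, gamma2S, SimpleGraph.fromEdgeSet_adj, Set.mem_insert_iff,
    Set.mem_singleton_iff, decide_eq_true_iff]
  decide +kernel

lemma describes2' : Describes targets2' 10 gamma2G gamma2S := by
  simp only [Describes, gamma2G, gamma2S, SimpleGraph.fromEdgeSet_adj, Set.mem_insert_iff,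
    Set.mem_singleton_iff, decide_eq_true_iff]
  decide +kernel

lemma describes3 : Describes targets3 0 gamma3G gamma3S := by
  simp only [Describes, gamma3G, gamma3S, SimpleGraph.fromEdgeSet_adj, Set.mem_insert_iff,
    Set.mem_singleton_iff, decide_eq_true_iff]
  decide +kernel

lemma describes3' : Describes targets3' 48 gamma3G gamma3S := by
  simp only [Describes, gamma3G, gamma3S, SimpleGraph.fromEdgeSet_adj, Set.mem_insert_iff,
    Set.mem_singleton_iff, decide_eq_true_iff]
  decide +kernel

lemma describes4 : Describes targets4 0 gamma4G gamma4S := by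
  simp only [Describes, gamma4G, gamma4S, SimpleGraph.fromEdgeSet_adj, Set.mem_insert_iff,
    Set.mem_singleton_iff, decide_eq_true_iff]
  decide +kernel

lemma describes4' : Describes targets4' 46 gamma4G gamma4S := by
  simp only [Describes, gamma4G, gamma4S, SimpleGraph.fromEdgeSet_adj, Set.mem_insert_iff,
    Set.mem_singleton_iff, decide_eq_true_iff]
  decide +kernel

lemma describes4'' : Describes targets4'' 54 gamma4G gamma4S := by
  simp only [Describes, gamma4G, gamma4S, SimpleGraph.fromEdgeSet_adj, Set.mem_insert_iff,
    Set.mem_singleton_iff, decide_eq_true_iff]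
  decide +kernel

lemma describes5 : Describes targets5 0 gamma5G gamma5S := by
  simp only [Describes, gamma5G, gamma5S, SimpleGraph.fromEdgeSet_adj, Set.mem_insert_iff,
    Set.mem_singleton_iff, decide_eq_true_iff]
  decide +kernel

end SearchCorrect

section

variable {V : Type*} {G : SimpleGraph V} {σ : Sym2 V → Bool} {c : V → Bool}

lemma bd_eq_sum (A B : Finset V) : bd G σ c A B = ∑ a ∈ A, bd G σ c {a} B := by
  simp [bd]

/-- The edge `ab` has a sign not explained by the colouring `c`. -/
def NegAdj (G : SimpleGraph V) (σ : Sym2 V → Bool) (c : V → Bool) (a b : V) : Prop :=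
  G.Adj a b ∧ σ s(a, b) ≠ xor (c a) (c b)

lemma NegAdj.symm {a b : V} (h : NegAdj G σ c a b) : NegAdj G σ c b a :=
  ⟨h.1.symm, by rw [Sym2.eq_swap, Bool.xor_comm]; exact h.2⟩

lemma xor_one_eq (i : ℕ) : i ^^^ 1 = if i % 2 = 0 then i + 1 else i - 1 := by
  split_ifs with h
  · exact Nat.xor_one_of_even (Nat.even_iff.mpr h)
  · exact Nat.xor_one_of_odd (Nat.odd_iff.mpr (by omega))

lemma bd_eq_zero {X : Finset V} (h : ∀ a ∈ X, ∀ b ∈ X, ¬ NegAdj G σ c a b) :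
    bd G σ c X X = 0 :=
  Finset.sum_eq_zero fun a ha => Finset.sum_eq_zero fun b hb => if_neg (h a ha b hb)

lemma NegAdj.irrefl (a : V) : ¬ NegAdj G σ c a a := fun h => h.1.ne rfl

lemma xor_one_lt {i k : ℕ} (hi : i < 2 * k) : i ^^^ 1 < 2 * k := by
  rw [xor_one_eq]
  split_ifs <;> omega

variable [Fintype V]

open Finset in
lemma sum_adj_and (P : Sym2 V → Prop) :
    (∑ a, ∑ b, if G.Adj a b ∧ P s(a, b) then 1 else 0) =
      2 * {e | e ∈ G.edgeSet ∧ P e}.ncard := by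
  let H : SimpleGraph V :=
    { Adj := fun a b => G.Adj a b ∧ P s(a, b)
      symm := ⟨fun a b h => ⟨h.1.symm, Sym2.eq_swap ▸ h.2⟩⟩
      loopless := ⟨fun a h => h.1.ne rfl⟩ }
  have hH : H.edgeSet = {e | e ∈ G.edgeSet ∧ P e} := by
    ext e
    induction e with
    | _ a b => rfl
  rw [← hH, ← SimpleGraph.coe_edgeFinset, Set.ncard_coe_finset, ← H.sum_degrees_eq_twice_card_edges]
  refine sum_congr rfl fun a _ => ?_
  rw [← H.card_neighborFinset_eq_degree, H.neighborFinset_eq_filter, card_filter]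

lemma bd_univ_eq_two_mul_negNum :
    bd G σ c Finset.univ Finset.univ = 2 * negNum G (sgnSwitch σ {v | c v = true}) := by
  rw [negNum, ← sum_adj_and]
  refine Finset.sum_congr rfl fun a _ => Finset.sum_congr rfl fun b _ => ?_
  simp only [sgnSwitch, sgnCross, Sym2.lift_mk, Set.mem_ofPred_eq, Bool.decide_eq_true]
  cases σ s(a, b) <;> cases c a <;> cases c b <;> simp

lemma twoConnOn_univ (h : TwoEdgeConn G) : TwoConnOn G Finset.univ := by
  intro X _ hX hXu
  have hXc : ((X : Set V)ᶜ).Nonempty := by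
    obtain ⟨x, hx⟩ := not_forall.mp (mt Finset.eq_univ_iff_forall.mpr hXu)
    exact ⟨x, by simpa using hx⟩
  have h2 := h X (by simpa using hX) hXc
  obtain ⟨P, hP⟩ : ∃ P : Sym2 V → Prop, ∀ e, P e ↔ sgnCross (X : Set V) e = true :=
    ⟨_, fun _ => Iff.rfl⟩
  have hP' : ∀ a b, P s(a, b) ↔ (a ∈ X ↔ b ∉ X) := fun a b => by
    rw [hP, sgnCross, Sym2.lift_mk, bne_iff_ne, Ne, decide_eq_decide]
    simp only [Finset.mem_coe]
    tauto
  have hc : 2 * cutSize G X = 2 * eb G X (Finset.univ \ X) := by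
    simp only [cutSize, ← hP]
    have h0 : ∀ A B : Finset V, (∀ a ∈ A, ∀ b ∈ B, ¬ P s(a, b)) →
        (∑ a ∈ A, ∑ b ∈ B, if G.Adj a b ∧ P s(a, b) then 1 else 0) = 0 :=
      fun A B h => Finset.sum_eq_zero fun a ha => Finset.sum_eq_zero fun b hb => by
        simp [h a ha b hb]
    have h1 : ∀ A B : Finset V, (∀ a ∈ A, ∀ b ∈ B, P s(a, b)) →
        (∑ a ∈ A, ∑ b ∈ B, if G.Adj a b ∧ P s(a, b) then 1 else 0) = eb G A B :=
      fun A B h => Finset.sum_congr rfl fun a ha => Finset.sum_congr rfl fun b hb => by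
        simp [h a ha b hb]
    have hs := Finset.union_sdiff_of_subset (Finset.subset_univ X)
    rw [← sum_adj_and]
    calc (∑ a, ∑ b, if G.Adj a b ∧ P s(a, b) then 1 else 0)
        = ∑ a ∈ X ∪ Finset.univ \ X, ∑ b ∈ X ∪ Finset.univ \ X,
          if G.Adj a b ∧ P s(a, b) then 1 else 0 := by rw [hs]
      _ = 2 * eb G X (Finset.univ \ X) := by
        simp only [Finset.sum_union Finset.disjoint_sdiff, Finset.sum_add_distrib]
        rw [h0 X X, h1 X, h1 _ X, h0, eb_comm G _ X] <;> simp_all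
        omega
  omega

lemma exists_minimal (G : SimpleGraph V) (σ : Sym2 V → Bool) : ∃ c : V → Bool,
    bd G σ c Finset.univ Finset.univ = 2 * frust G σ ∧
      ∀ c', bd G σ c Finset.univ Finset.univ ≤ bd G σ c' Finset.univ Finset.univ := by
  obtain ⟨X, hX⟩ : frust G σ ∈ Set.range fun X => negNum G (sgnSwitch σ X) :=
    Nat.sInf_mem (Set.range_nonempty _)
  have hc : bd G σ (fun v => decide (v ∈ X)) Finset.univ Finset.univ = 2 * frust G σ := by
    rw [bd_univ_eq_two_mul_negNum, ← hX]
    simp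
  refine ⟨_, hc, fun c' => ?_⟩
  rw [hc, bd_univ_eq_two_mul_negNum]
  exact Nat.mul_le_mul_left 2 (Nat.sInf_le ⟨_, rfl⟩)

/-- The colouring `c` leaves as few edges unexplained as possible. -/
def IsMinimal (G : SimpleGraph V) (σ : Sym2 V → Bool) (c : V → Bool) : Prop :=
  ∀ c', bd G σ c Finset.univ Finset.univ ≤ bd G σ c' Finset.univ Finset.univ

lemma IsMinimal.cut_le (h : IsMinimal G σ c) (X : Finset V) :
    2 * (∑ v ∈ X, bd G σ c {v} Finset.univ) + eb G X X ≤
      (∑ v ∈ X, eb G {v} Finset.univ) + 2 * bd G σ c X X := by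
  have hsplit := Finset.union_sdiff_of_subset (Finset.subset_univ X)
  have hd : Disjoint X (Finset.univ \ X) := Finset.disjoint_sdiff
  let c' : V → Bool := fun v => if v ∈ X then c v else !(c v)
  have hcX : ∀ v ∈ X, c' v = c v := fun v hv => by simp [c', hv]
  have hcY : ∀ v ∈ Finset.univ \ X, c' v = !(c v) := fun v hv => by
    simp [c', (Finset.mem_sdiff.mp hv).2]
  have h1 : bd G σ c' X X = bd G σ c X X := bd_congr _ hcX hcX
  have h2 : bd G σ c' (Finset.univ \ X) (Finset.univ \ X) =
      bd G σ c (Finset.univ \ X) (Finset.univ \ X) := by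
    refine Finset.sum_congr rfl fun a ha => Finset.sum_congr rfl fun b hb => ?_
    rw [hcY a ha, hcY b hb, Bool.not_xor_not]
  have h3 : bd G σ c X (Finset.univ \ X) + bd G σ c' X (Finset.univ \ X) =
      eb G X (Finset.univ \ X) := by
    unfold bd eb
    rw [← Finset.sum_add_distrib]
    refine Finset.sum_congr rfl fun a ha => ?_
    rw [← Finset.sum_add_distrib]
    refine Finset.sum_congr rfl fun b hb => ?_
    rw [hcY b hb, hcX a ha]
    by_cases hab : G.Adj a b <;> cases σ s(a, b) <;> cases c a <;> cases c b <;> simp [hab]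
  have h4 := h c'
  rw [← hsplit, bd_union_self G σ c hd, bd_union_self G σ c' hd, h1, h2] at h4
  have h5 : bd G σ c X Finset.univ = bd G σ c X X + bd G σ c X (Finset.univ \ X) := by
    rw [← bd_union_right G σ c X hd, hsplit]
  have h6 : eb G X Finset.univ = eb G X X + eb G X (Finset.univ \ X) := by
    rw [← eb_union_right G X hd, hsplit]
  rw [bd_eq_sum] at h5
  rw [eb_eq_sum] at h6
  omega

lemma bd_singleton_eq_card (a : V) :
    bd G σ c {a} Finset.univ = (Finset.univ.filter (NegAdj G σ c a)).card := by
  rw [bd, Finset.sum_singleton, Finset.card_filter]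
  refine Finset.sum_congr rfl fun b _ => ?_
  congr

lemma IsMinimal.bd_le_one (h : IsMinimal G σ c) {v : V} (hv : eb G {v} Finset.univ ≤ 3) :
    bd G σ c {v} Finset.univ ≤ 1 := by
  have := h.cut_le {v}
  have h0 : bd G σ c {v} {v} = 0 := by simp [bd]
  rw [Finset.sum_singleton, Finset.sum_singleton, h0] at this
  omega

lemma NegAdj.eq {a b b' : V} (ha : bd G σ c {a} Finset.univ ≤ 1) (h : NegAdj G σ c a b)
    (h' : NegAdj G σ c a b') : b = b' := by
  rw [bd_singleton_eq_card] at ha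
  exact Finset.card_le_one.mp ha b (by simpa using h) b' (by simpa using h')

lemma NegAdj.bd_pos {a b : V} (h : NegAdj G σ c a b) : 1 ≤ bd G σ c {a} Finset.univ := by
  rw [bd_singleton_eq_card]
  exact Finset.card_pos.mpr ⟨b, by simpa using h⟩

/-- When the unexplained edges form a matching with `k` edges, its vertices can be numbered. -/
lemma exists_enumeration [Nonempty V] {k : ℕ} (hk : bd G σ c Finset.univ Finset.univ = 2 * k)
    (h1 : ∀ v, bd G σ c {v} Finset.univ ≤ 1) {j : ℕ} (hj : j ≤ k) :
    ∃ g : ℕ → V, Set.InjOn g {i | i < 2 * j} ∧ ∀ i < 2 * j, NegAdj G σ c (g i) (g (i ^^^ 1)) := by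
  induction j with
  | zero =>
    exact ⟨fun _ => Classical.arbitrary V, by simp [Set.InjOn], by simp⟩
  | succ j ih =>
    obtain ⟨g, hg, hN⟩ := ih (by omega)
    let U := (Finset.range (2 * j)).image g
    have hU : U.card ≤ 2 * j := Finset.card_image_le.trans (by simp)
    obtain ⟨a, haU, ha⟩ : ∃ a ∉ U, 0 < bd G σ c {a} Finset.univ := by
      by_contra! hcon
      have : bd G σ c Finset.univ Finset.univ = ∑ v ∈ U, bd G σ c {v} Finset.univ := by
        rw [bd_eq_sum]
        exact (Finset.sum_subset (Finset.subset_univ U) fun v _ hv => by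
          have := hcon v hv
          omega).symm
      have := Finset.sum_le_card_nsmul U _ 1 fun v _ => h1 v
      rw [smul_eq_mul] at this
      omega
    rw [bd_singleton_eq_card, Finset.card_pos] at ha
    obtain ⟨b, hb⟩ := ha
    have hab : NegAdj G σ c a b := by simpa using hb
    have hgU : ∀ i < 2 * j, g i ∈ U := fun i hi =>
      Finset.mem_image_of_mem g (Finset.mem_range.mpr hi)
    have hbU : b ∉ U := fun hb => by
      obtain ⟨i, hi, rfl⟩ := Finset.mem_image.mp hb
      rw [Finset.mem_range] at hi
      refine haU ?_
      rw [hab.symm.eq (h1 _) (hN i hi)]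
      refine hgU _ ?_
      rw [xor_one_eq]
      split_ifs <;> omega
    refine ⟨fun i => if i < 2 * j then g i else if i = 2 * j then a else b, ?_, ?_⟩
    · intro i hi i' hi' h
      simp only [Set.mem_ofPred_eq] at hi hi'
      have hne : a ≠ b := hab.1.ne
      have hg' : ∀ i < 2 * j, g i ≠ a ∧ g i ≠ b := fun i hi =>
        ⟨fun h => haU (h ▸ hgU i hi), fun h => hbU (h ▸ hgU i hi)⟩
      by_cases h1 : i < 2 * j <;> by_cases h2 : i' < 2 * j
      · simp only [h1, h2, if_true] at h
        exact hg h1 h2 h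
      · have := hg' i h1
        grind
      · have := hg' i' h2
        grind
      · grind
    · intro i hi
      have hx := xor_one_eq i
      by_cases h1 : i < 2 * j
      · have : i ^^^ 1 < 2 * j := by grind
        simpa [h1, this] using hN i h1
      · by_cases h2 : i = 2 * j
        · have : i ^^^ 1 = 2 * j + 1 := by grind
          simpa [h1, h2, this] using hab
        · have : i ^^^ 1 = 2 * j := by grind
          simpa [h1, h2, this] using hab.symm

end

section

variable {V : Type*} [Fintype V] {G : SimpleGraph V} {σ : Sym2 V → Bool} {c : V → Bool}

lemma IsMinimal.cut_pair {a b : V} (h : IsMinimal G σ c) (hab : G.Adj a b)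
    (hn : ¬ NegAdj G σ c a b) :
    2 * (bd G σ c {a} Finset.univ + bd G σ c {b} Finset.univ) + 2 ≤
      eb G {a} Finset.univ + eb G {b} Finset.univ := by
  have hn' : ¬ NegAdj G σ c b a := fun h => hn h.symm
  have h1 := h.cut_le {a, b}
  rw [bd_eq_zero (by simp [hn, hn', NegAdj.irrefl]), Finset.sum_pair hab.ne,
    Finset.sum_pair hab.ne] at h1
  have h2 : eb G {a, b} {a, b} = 2 := by
    simp [eb, Finset.sum_pair hab.ne, hab, hab.symm]
  omega

lemma IsMinimal.cut_triple {a b d : V} (h : IsMinimal G σ c) (hab : G.Adj a b) (had : G.Adj a d)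
    (hbd : b ≠ d) (hnb : ¬ NegAdj G σ c a b) (hnd : ¬ NegAdj G σ c a d)
    (hn : ¬ NegAdj G σ c b d) :
    2 * (bd G σ c {a} Finset.univ + bd G σ c {b} Finset.univ + bd G σ c {d} Finset.univ) + 4 +
        (if G.Adj b d then 2 else 0) ≤
      eb G {a} Finset.univ + eb G {b} Finset.univ + eb G {d} Finset.univ := by
  have hnb' : ¬ NegAdj G σ c b a := fun h => hnb h.symm
  have hnd' : ¬ NegAdj G σ c d a := fun h => hnd h.symm
  have hn' : ¬ NegAdj G σ c d b := fun h => hn h.symm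
  have ha : a ∉ ({b, d} : Finset V) := by simp [hab.ne, had.ne]
  have h1 := h.cut_le {a, b, d}
  rw [bd_eq_zero (by simp [hnb, hnb', hnd, hnd', hn, hn', NegAdj.irrefl]),
    Finset.sum_insert ha, Finset.sum_pair hbd, Finset.sum_insert ha, Finset.sum_pair hbd] at h1
  have h2 : eb G {a, b, d} {a, b, d} = 4 + if G.Adj b d then 2 else 0 := by
    simp only [eb, Finset.sum_insert ha, Finset.sum_pair hbd, hab, hab.symm, had, had.symm,
      G.adj_comm d b, SimpleGraph.irrefl, if_true, if_false]
    split_ifs <;> rfl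
  omega

lemma partner_iff {k i j : ℕ} : partner k i j = true ↔ i ^^^ 1 = j ∧ i < 2 * k := by
  simp [partner, Nat.blt_eq]

/-- `f` numbers the vertices of `G` so that the edges unexplained by the optimal colouring `c` are
the first `k` pairs, and `m` is the adjacency matrix. -/
structure IsNumbering (G : SimpleGraph V) (σ : Sym2 V → Bool) (c : V → Bool) (k lo : ℕ) {n : ℕ}
    (f : Fin n ≃ V) (m : Fin n → ℕ) : Prop where
  minimal : IsMinimal G σ c
  matching : IsNegMatching G σ c k f
  two_mul_le : 2 * k ≤ n
  matrix : IsMatrix G f m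
  lt : ∀ i, m i < 2 ^ n
  deg : ∀ v, eb G {v} Finset.univ = 3 ∨ eb G {v} Finset.univ = lo
  low : lo ≤ 3
  low_unique : ∀ u v, eb G {u} Finset.univ = 3 ∨ eb G {v} Finset.univ = 3 ∨ u = v

namespace IsNumbering

variable {k lo n : ℕ} {f : Fin n ≃ V} {m : Fin n → ℕ} (h : IsNumbering G σ c k lo f m)
include h

lemma bits_eq (i : Fin n) : bits n (m i) = eb G {f i} Finset.univ := by
  have h1 : bits n (m i) = ∑ j ∈ Finset.range n, if (m i).testBit j = true then 1 else 0 := by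
    rw [← Finset.card_filter, bits, ← List.toFinset_card_of_nodup (List.nodup_range.filter _)]
    congr 1
    ext j
    simp
  rw [h1, ← Fin.sum_univ_eq_sum_range fun j => if (m i).testBit j = true then 1 else 0, eb,
    Finset.sum_singleton, ← f.sum_comp]
  refine Finset.sum_congr rfl fun j _ => ?_
  simp only [h.matrix i j]

lemma half_eq {i j : Fin n} (hij : NegAdj G σ c (f i) (f j)) : (i : ℕ) / 2 = j / 2 := by
  have h1 := (partner_iff.mp ((h.matching i j).mpr hij)).1
  rw [xor_one_eq] at h1
  split_ifs at h1 <;> omega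

lemma negAdj_xor {i : Fin n} (hi : (i : ℕ) < 2 * k) :
    NegAdj G σ c (f i) (f ⟨i ^^^ 1, (xor_one_lt hi).trans_le h.two_mul_le⟩) :=
  (h.matching _ _).mp (partner_iff.mpr ⟨rfl, hi⟩)

lemma one_le_bd {i : Fin n} (hi : (i : ℕ) < 2 * k) : 1 ≤ bd G σ c {f i} Finset.univ :=
  (h.negAdj_xor hi).bd_pos

lemma deg_le (v : V) : eb G {v} Finset.univ ≤ 3 := by
  have := h.low
  rcases h.deg v with h | h <;> omega

lemma deg_eq {i j : Fin n} (hi : (i : ℕ) < 2 * k) (hj : (j : ℕ) < 2 * k) (hij : (i : ℕ) / 2 ≠ j / 2)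
    (hadj : G.Adj (f i) (f j)) : eb G {f i} Finset.univ = 3 := by
  have h1 := h.minimal.cut_pair hadj fun hn => hij (h.half_eq hn)
  have h2 := h.one_le_bd hi
  have h3 := h.one_le_bd hj
  have h4 := h.deg_le (f i)
  have h5 := h.deg_le (f j)
  omega

lemma not_adj {i j l : Fin n} (hi : (i : ℕ) < 2 * k) (hj : (j : ℕ) < 2 * k) (hl : (l : ℕ) < 2 * k)
    (hij : (i : ℕ) / 2 ≠ j / 2) (hil : (i : ℕ) / 2 ≠ l / 2) (hjl : (j : ℕ) / 2 ≠ l / 2)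
    (hadj : G.Adj (f i) (f j)) : ¬ G.Adj (f i) (f l) := fun hadj' => by
  have h1 := h.minimal.cut_triple hadj hadj' (fun he => hjl (by rw [f.injective he]))
    (fun hn => hij (h.half_eq hn)) (fun hn => hil (h.half_eq hn)) (fun hn => hjl (h.half_eq hn))
  have h2 := h.one_le_bd hi
  have h3 := h.one_le_bd hj
  have h4 := h.one_le_bd hl
  have h5 := h.deg_le (f i)
  have h6 := h.deg_le (f j)
  have h7 := h.deg_le (f l)
  omega

lemma not_triangle {i j l : Fin n} (hi : (i : ℕ) < 2 * k) (hj : (j : ℕ) < 2 * k)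
    (hl : ¬ (l : ℕ) < 2 * k) (hij : (j : ℕ) / 2 ≠ i / 2) (hadj : G.Adj (f i) (f j))
    (hil : G.Adj (f i) (f l)) : ¬ G.Adj (f l) (f j) := fun hlj => by
  have hne : ∀ p : Fin n, (p : ℕ) < 2 * k → ¬ NegAdj G σ c (f p) (f l) := fun p hp hn => by
    have := h.half_eq hn
    omega
  have h1 := h.minimal.cut_triple hadj hil hlj.ne' (fun hn => hij (h.half_eq hn).symm) (hne i hi)
    (hne j hj)
  rw [if_pos hlj.symm] at h1
  have h2 := h.one_le_bd hi
  have h3 := h.one_le_bd hj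
  have h5 := h.deg_le (f i)
  have h6 := h.deg_le (f j)
  have h7 := h.deg_le (f l)
  omega

lemma not_complete (hS : TwoConnOn G Finset.univ) (hn : 4 < n) {a b d e : Fin n}
    (hab : G.Adj (f a) (f b)) (had : G.Adj (f a) (f d)) (hae : G.Adj (f a) (f e))
    (hbd : G.Adj (f b) (f d)) (hbe : G.Adj (f b) (f e)) : ¬ G.Adj (f d) (f e) := fun hde => by
  have ha : f a ∉ ({f b, f d, f e} : Finset V) := by simp [hab.ne, had.ne, hae.ne]
  have hb : f b ∉ ({f d, f e} : Finset V) := by simp [hbd.ne, hbe.ne]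
  let X : Finset V := {f a, f b, f d, f e}
  have hX : eb G X X = 12 := by
    simp only [X, eb, Finset.sum_insert ha, Finset.sum_insert hb, Finset.sum_pair hde.ne, hab,
      hab.symm, had, had.symm, hae, hae.symm, hbd, hbd.symm, hbe, hbe.symm, hde, hde.symm,
      SimpleGraph.irrefl, if_true, if_false]
    rfl
  have hcard : X.card = 4 := by
    rw [Finset.card_insert_of_notMem ha, Finset.card_insert_of_notMem hb, Finset.card_pair hde.ne]
  have h1 := hS X (Finset.subset_univ X) ⟨f a, by simp [X]⟩ fun hu => by
    rw [hu, Finset.card_univ, ← Fintype.card_congr f, Fintype.card_fin] at hcard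
    omega
  have h2 : eb G X Finset.univ = eb G X X + eb G X (Finset.univ \ X) := by
    rw [← eb_union_right G X Finset.disjoint_sdiff,
      Finset.union_sdiff_of_subset (Finset.subset_univ X)]
  have h3 := Finset.sum_le_card_nsmul X _ 3 fun v _ => h.deg_le v
  rw [← eb_eq_sum, hcard, smul_eq_mul] at h3
  omega

lemma testBit {i : Fin n} {j : ℕ} (hj : j < n) :
    (m i).testBit j = true ↔ G.Adj (f i) (f ⟨j, hj⟩) := h.matrix i ⟨j, hj⟩

lemma rowOK (i : Fin n) : rowOK n k lo i (m i) = true := by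
  have hn : ∀ j < 2 * k, j < n := fun j hj => hj.trans_le h.two_mul_le
  simp only [SubcubicFrustration.rowOK, Bool.and_eq_true, Bool.or_eq_true, beq_iff_eq,
    Bool.not_eq_true', ← Bool.not_eq_true, List.all_eq_true, List.mem_range, Nat.blt_eq,
    h.bits_eq, h.matrix i i]
  refine ⟨⟨h.deg _, G.irrefl⟩, or_iff_not_imp_left.mpr fun hi => ?_⟩
  rw [not_not] at hi
  refine ⟨(h.testBit _).mpr (h.negAdj_xor hi).1, fun j hj => ?_⟩
  by_cases hij : j / 2 = i / 2
  · exact .inl (.inr hij)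
  refine or_assoc.mpr (or_iff_not_imp_left.mpr fun hadj => .inr ?_)
  rw [not_not, h.testBit (hn j hj)] at hadj
  refine ⟨h.deg_eq hi hj (Ne.symm hij) hadj, fun l hl => ?_⟩
  by_contra! hcon
  obtain ⟨⟨h1, h2⟩, h3⟩ := hcon
  rw [h.testBit (hn l hl)] at h1
  exact h.not_adj hi hj hl (Ne.symm hij) (Ne.symm h2) h3 hadj h1

lemma pairOK (hS : TwoConnOn G Finset.univ) (hn4 : 4 < n) {i j : Fin n} (hij : i ≠ j) :
    pairOK n k lo ⟨i, m i⟩ ⟨j, m j⟩ = true := by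
  have hn : ∀ j < 2 * k, j < n := fun j hj => hj.trans_le h.two_mul_le
  have hsymm : ((m i).testBit j == (m j).testBit i) = true := by
    rw [beq_iff_eq, Bool.eq_iff_iff, h.matrix i j, h.matrix j i, G.adj_comm]
  simp only [SubcubicFrustration.pairOK, hsymm, cond_true, Bool.and_eq_true, Bool.or_eq_true,
    beq_iff_eq, Bool.not_eq_true', ← Bool.not_eq_true, List.all_eq_true, List.mem_range,
    Nat.blt_eq, h.bits_eq, h.matrix i j]
  refine ⟨⟨?_, ?_⟩, ?_⟩
  · refine or_iff_not_imp_left.mpr fun h1 b hb => or_iff_not_imp_left.mpr fun h2 => ?_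
    rw [not_not] at h1
    rintro ⟨h3, h4⟩
    rw [h.testBit (hn b hb)] at h3 h4
    exact h.not_triangle (j := ⟨b, hn b hb⟩) h1.1.1 hb h1.1.2 h2 h3 h1.2 h4
  · refine or_iff_not_imp_left.mpr fun h1 b hb => ?_
    rw [not_not, h.matching] at h1
    rintro ⟨⟨⟨h2, h3⟩, h4⟩, h5⟩
    have hb2 := hn (2 * b) (by omega)
    have hb3 := hn (2 * b + 1) (by omega)
    rw [h.testBit hb2] at h2 h4
    rw [h.testBit hb3] at h3 h5
    refine h.not_complete hS hn4 h1.1 h2 h3 h4 h5 ((h.matching _ _).mp ?_).1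
    refine partner_iff.mpr ⟨?_, by simp; omega⟩
    simp
  · rcases h.low_unique (f i) (f j) with h1 | h1 | h1
    · exact .inl (.inr h1)
    · exact .inr h1
    · exact absurd (f.injective h1) hij

lemma leaf_of_search {leaf : List Row → Bool} (hS : TwoConnOn G Finset.univ) (hn : 4 < n)
    (hs : search (SubcubicFrustration.pairOK n k lo) leaf ((List.range n).map (rows n k lo)) [] =
      true) : leaf (List.ofFn fun i : Fin n => Row.mk i (m i)).reverse = true := by
  have hC : (List.range n).map (rows n k lo) = List.ofFn fun i : Fin n => rows n k lo i :=
    List.ext_getElem (by simp) (by simp)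
  rw [hC, search_ofFn] at hs
  refine hs _ (fun i => ?_) fun i j hij => h.pairOK hS hn hij.ne
  exact List.mem_map_of_mem (List.mem_filter.mpr ⟨List.mem_range.mpr (h.lt i), h.rowOK i⟩)

end IsNumbering

end

section

variable {V : Type*} {G : SimpleGraph V} {σ : Sym2 V → Bool} {c : V → Bool}

lemma exists_isMatrix {n : ℕ} (G : SimpleGraph V) (f : Fin n ≃ V) :
    ∃ m : Fin n → ℕ, IsMatrix G f m ∧ ∀ i, m i < 2 ^ n :=
  ⟨fun i => Nat.ofBits fun j => decide (G.Adj (f i) (f j)), fun i j => by simp,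
    fun i => Nat.ofBits_lt_two_pow _⟩

variable [Fintype V]

lemma exists_isNegMatching [Nonempty V] {k n : ℕ} (hcard : Fintype.card V = n)
    (hk : bd G σ c Finset.univ Finset.univ = 2 * k) (h1 : ∀ v, bd G σ c {v} Finset.univ ≤ 1) :
    2 * k ≤ n ∧ ∃ f : Fin n ≃ V, IsNegMatching G σ c k f := by
  have hkn : 2 * k ≤ n := by
    have := Finset.sum_le_card_nsmul Finset.univ _ 1 fun v _ => h1 v
    rwa [← bd_eq_sum, hk, smul_eq_mul, mul_one, Finset.card_univ, hcard] at this
  obtain ⟨g, hg, hN⟩ := exists_enumeration hk h1 le_rfl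
  obtain ⟨e, he⟩ := Finset.exists_equiv_extend_of_card_eq (α := Fin n) (t := Finset.univ)
    (s := Finset.univ.filter fun i : Fin n => (i : ℕ) < 2 * k) (f := fun i => g i)
    (by rw [Fintype.card_fin, Finset.card_univ, hcard]) (Finset.subset_univ _)
    fun i hi j hj hij => Fin.ext (hg (by simpa using hi) (by simpa using hj) hij)
  let f : Fin n ≃ V := e.trans (Equiv.subtypeUnivEquiv Finset.mem_univ)
  have hf : ∀ i : Fin n, (i : ℕ) < 2 * k → f i = g i := fun i hi => he i (by simpa using hi)
  let U := (Finset.range (2 * k)).image g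
  have hU : U.card = 2 * k := by
    rw [Finset.card_image_of_injOn fun i hi j hj => hg (by simpa using hi) (by simpa using hj),
      Finset.card_range]
  have hsum : 2 * k ≤ ∑ v ∈ U, bd G σ c {v} Finset.univ := by
    have := Finset.card_nsmul_le_sum U (fun v => bd G σ c {v} Finset.univ) 1 fun v hv => by
      obtain ⟨i, hi, rfl⟩ := Finset.mem_image.mp hv
      exact (hN i (Finset.mem_range.mp hi)).bd_pos
    rwa [hU, smul_eq_mul, mul_one] at this
  have hout : ∀ v ∉ U, ∀ w, ¬ NegAdj G σ c v w := fun v hv w hvw => by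
    have h2 := hvw.bd_pos
    have h3 := Finset.sum_le_sum_of_subset (f := fun v => bd G σ c {v} Finset.univ)
      (Finset.subset_univ (insert v U))
    rw [Finset.sum_insert hv, ← bd_eq_sum Finset.univ, hk] at h3
    omega
  refine ⟨hkn, f, fun i j => partner_iff.trans ⟨?_, fun hij => ?_⟩⟩
  · rintro ⟨hij, hi⟩
    rw [hf i hi, hf j (hij ▸ xor_one_lt hi), ← hij]
    exact hN i hi
  · have hi : (i : ℕ) < 2 * k := by
      by_contra hi
      refine hout (f i) (fun hv => ?_) _ hij
      obtain ⟨l, hl, hlv⟩ := Finset.mem_image.mp hv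
      rw [Finset.mem_range] at hl
      rw [← hf ⟨l, hl.trans_le hkn⟩ hl] at hlv
      exact hi (by rwa [← f.injective hlv])
    refine ⟨?_, hi⟩
    have h2 := hN i hi
    rw [← hf i hi, ← hf ⟨_, (xor_one_lt hi).trans_le hkn⟩ (xor_one_lt hi)] at h2
    exact congrArg Fin.val (f.injective (h2.eq (h1 _) hij))

lemma exists_isNumbering [Nonempty V] {k lo n : ℕ} (hcard : Fintype.card V = n)
    (hk : bd G σ c Finset.univ Finset.univ = 2 * k) (hc : IsMinimal G σ c)
    (hdeg : ∀ v, eb G {v} Finset.univ = 3 ∨ eb G {v} Finset.univ = lo) (hlo : lo ≤ 3)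
    (hu : ∀ u v, eb G {u} Finset.univ = 3 ∨ eb G {v} Finset.univ = 3 ∨ u = v) :
    ∃ (f : Fin n ≃ V) (m : Fin n → ℕ), IsNumbering G σ c k lo f m := by
  obtain ⟨hkn, f, hf⟩ := exists_isNegMatching hcard hk fun v => hc.bd_le_one <| by
    rcases hdeg v with h | h <;> omega
  obtain ⟨m, hm, hlt⟩ := exists_isMatrix G f
  exact ⟨f, m, hc, hf, hkn, hm, hlt, hdeg, hlo, hu⟩

lemma siso_of_card_eq_four [Nonempty V] (hcard : Fintype.card V = 4)
    (hk : bd G σ c Finset.univ Finset.univ = 2 * 2) (hc : IsMinimal G σ c)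
    (hdeg : ∀ v, eb G {v} Finset.univ = 3) : SIso G σ gamma1G gamma1S := by
  obtain ⟨f, m, h⟩ := exists_isNumbering (lo := 3) hcard hk hc (fun v => .inl (hdeg v)) le_rfl
    fun u _ => .inl (hdeg u)
  have hadj : ∀ i j : Fin 4, G.Adj (f i) (f j) ↔ i ≠ j := fun i j => by
    have h1 : Finset.univ.filter (G.Adj (f i)) = Finset.univ.erase (f i) := by
      refine Finset.eq_of_subset_of_card_le (fun v hv => ?_) ?_
      · exact Finset.mem_erase.mpr ⟨(Finset.mem_filter.mp hv).2.ne', Finset.mem_univ v⟩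
      · rw [← eb_singleton, hdeg, Finset.card_erase_of_mem (Finset.mem_univ _), Finset.card_univ,
          hcard]
    have h2 := Finset.ext_iff.mp h1 (f j)
    simpa [eq_comm] using h2
  have hm : m = fun i => Nat.ofBits fun j : Fin 4 => decide (i ≠ j) := by
    funext i
    refine Nat.eq_of_testBit_eq fun j => ?_
    rw [Nat.testBit_ofBits]
    split_ifs with hj
    · rw [Bool.eq_iff_iff, decide_eq_true_iff, h.testBit hj, hadj]
    · exact Nat.testBit_lt_two_pow ((h.lt i).trans_le (Nat.pow_le_pow_right two_pos (by omega)))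
  refine siso_of_isoTo h.matrix h.matching describes1 ?_
  rw [hm]
  exact isoTo_four

lemma siso_of_card_eq_five [Nonempty V] (hS : TwoConnOn G Finset.univ)
    (hcard : Fintype.card V = 5)
    (hk : bd G σ c Finset.univ Finset.univ = 2 * 2) (hc : IsMinimal G σ c)
    (hdeg : ∀ v, eb G {v} Finset.univ = 3 ∨ eb G {v} Finset.univ = 2)
    (hu : ∀ u v, eb G {u} Finset.univ = 3 ∨ eb G {v} Finset.univ = 3 ∨ u = v) :
    SIso G σ gamma2G gamma2S := by
  obtain ⟨f, m, h⟩ := exists_isNumbering hcard hk hc hdeg (by norm_num) hu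
  have := h.leaf_of_search hS (by norm_num) search_five
  rcases Bool.or_eq_true_iff.mp this with h1 | h1
  · exact siso_of_isoTo h.matrix h.matching describes2 h1
  · exact siso_of_isoTo h.matrix h.matching describes2' h1

lemma siso_of_card_eq_eight [Nonempty V] (hS : TwoConnOn G Finset.univ)
    (hcard : Fintype.card V = 8)
    (hk : bd G σ c Finset.univ Finset.univ = 2 * 3) (hc : IsMinimal G σ c)
    (hdeg : ∀ v, eb G {v} Finset.univ = 3) :
    SIso G σ gamma3G gamma3S ∨ SIso G σ gamma4G gamma4S ∨ SIso G σ gamma5G gamma5S := by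
  obtain ⟨f, m, h⟩ := exists_isNumbering (lo := 3) hcard hk hc (fun v => .inl (hdeg v)) le_rfl
    fun u _ => .inl (hdeg u)
  have := h.leaf_of_search hS (by norm_num) search_eight
  simp only [Bool.or_eq_true] at this
  rcases this with ((((h1 | h1) | h1) | h1) | h1) | h1
  · exact .inr (.inl (siso_of_isoTo h.matrix h.matching describes4' h1))
  · exact .inr (.inl (siso_of_isoTo h.matrix h.matching describes4 h1))
  · exact .inr (.inl (siso_of_isoTo h.matrix h.matching describes4'' h1))
  · exact .inl (siso_of_isoTo h.matrix h.matching describes3' h1)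
  · exact .inr (.inr (siso_of_isoTo h.matrix h.matching describes5 h1))
  · exact .inl (siso_of_isoTo h.matrix h.matching describes3 h1)

lemma two_le_eb (hS : TwoConnOn G Finset.univ) (hV : 1 < Fintype.card V) (v : V) :
    2 ≤ eb G {v} Finset.univ := by
  refine (hS {v} (Finset.subset_univ _) ⟨v, by simp⟩ fun h => ?_).trans
    (eb_mono_right G _ (Finset.subset_univ _))
  have := congrArg Finset.card h
  rw [Finset.card_singleton, Finset.card_univ] at this
  omega

/-- A signed graph violating the bound is one of the five exceptions. -/
lemma siso_of_exceptional {k : ℕ} (hS : TwoConnOn G Finset.univ)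
    (hdeg : ∀ v, eb G {v} Finset.univ ≤ 3) (hX : Exceptional G Finset.univ k)
    (hk : bd G σ c Finset.univ Finset.univ = 2 * k) (hc : IsMinimal G σ c) :
    SIso G σ gamma1G gamma1S ∨ SIso G σ gamma2G gamma2S ∨ SIso G σ gamma3G gamma3S ∨
      SIso G σ gamma4G gamma4S ∨ SIso G σ gamma5G gamma5S := by
  rw [Exceptional, Finset.card_univ] at hX
  have : Nonempty V := Fintype.card_pos_iff.mp (by omega)
  have hdeg2 := two_le_eb hS (by omega)
  rcases hX with ⟨hV, h, rfl⟩ | ⟨hV, h, rfl⟩ | ⟨hV, h, rfl⟩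
  · exact .inl (siso_of_card_eq_four hV hk hc fun v => h v (Finset.mem_univ v))
  · refine .inr (.inl (siso_of_card_eq_five hS hV hk hc (fun v => ?_) fun u v => ?_))
    · have h1 := hdeg v
      have h2 := hdeg2 v
      omega
    · have h1 := hdeg u
      have h2 := hdeg v
      have h3 := h u (Finset.mem_univ u) v (Finset.mem_univ v)
      by_cases huv : u = v
      · exact .inr (.inr huv)
      · have : ¬ (eb G {u} Finset.univ ≤ 2 ∧ eb G {v} Finset.univ ≤ 2) := fun h => huv (h3 h.1 h.2)
        omega
  · exact .inr (.inr (siso_of_card_eq_eight hS hV hk hc fun v => h v (Finset.mem_univ v)))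

end

end SubcubicFrustration

open SubcubicFrustration

/-- Every signed 2-edge-connected simple subcubic graph other than the
five exceptional signed graphs `Γ̂₁, …, Γ̂₅` satisfies `F(G, σ) ≤ v(G)/3`. -/
theorem frust_le_third_of_twoEdgeConn_subcubic {V : Type*} [Fintype V]
    (G : SimpleGraph V) (σ : Sym2 V → Bool)
    (h2ec : TwoEdgeConn G)
    (hsub : ∀ v : V, (G.neighborSet v).ncard ≤ 3)
    (h1 : ¬ SIso G σ gamma1G gamma1S) (h2 : ¬ SIso G σ gamma2G gamma2S)
    (h3 : ¬ SIso G σ gamma3G gamma3S) (h4 : ¬ SIso G σ gamma4G gamma4S)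
    (h5 : ¬ SIso G σ gamma5G gamma5S) :
    3 * frust G σ ≤ Fintype.card V := by
  have hS : TwoConnOn G Finset.univ := twoConnOn_univ h2ec
  have hdeg : ∀ v, eb G {v} Finset.univ ≤ 3 := fun v => by
    rw [eb_singleton, ← Set.ncard_coe_finset]
    convert hsub v using 2
    ext w
    simp
  obtain ⟨c, hc, hmin⟩ := exists_minimal G σ
  obtain ⟨k, ⟨c', hc'⟩, hk⟩ := bounded_of_twoConnOn (σ := σ) hS fun v _ => hdeg v
  have hle : frust G σ ≤ k := by
    have := (hmin c').trans hc'
    omega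
  rcases hk with hk | hk
  · rw [Finset.card_univ] at hk
    omega
  · rcases hle.eq_or_lt with heq | hlt
    · have := siso_of_exceptional hS hdeg hk (heq ▸ hc) hmin
      tauto
    · rw [Exceptional, Finset.card_univ] at hk
      omega
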